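/- Suppose that s ≥ 2 and 𝒞(x₁,…,x_s) is a cubic form with integer coefficients which is not of the shape a(b₁x₁+⋯+b_sx_s)³ for rational numbers a, b₁,…,b_s. For P ≥ 2 let M(P) denote the number of pairs of integer vectors x, X ∈ [-P,P]^s with 𝒞(x) = 𝒞(X). Then for every ε > 0 there is a constant C (depending on 𝒞 and ε) such that M(P) ≤ C·P^{2s-2+ε} for all P ≥ 2. -/

import Mathlib

open MvPolynomial

theorem Nat.exists_card_divisors_le_rpow (δ : ℝ) (hδ : 0 < δ) :
    ∃ K : ℝ, 1 ≤ K ∧ ∀ n : ℕ, n ≠ 0 → (n.divisors.card : ℝ) ≤ K * (n : ℝ) ^ δ := by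
  obtain ⟨m, hm⟩ := exists_nat_ge ((2 : ℝ) ^ (1 / δ))
  have hl : 0 < δ * Real.log 2 := mul_pos hδ (Real.log_pos one_lt_two)
  set c : ℝ := 1 + 1 / (δ * Real.log 2) with hc
  have hc1 : 1 ≤ c := by rw [hc]; have := one_div_pos.mpr hl; linarith
  have hlocal : ∀ p : ℕ, p.Prime → ∀ a : ℕ,
      ((a : ℝ) + 1) ≤ (if p < m then c else 1) * ((p : ℝ) ^ a) ^ δ := by
    intro p hp a
    have hp2 : (2 : ℝ) ≤ p := by exact_mod_cast hp.two_le
    have hcomm : ((p : ℝ) ^ a) ^ δ = ((p : ℝ) ^ δ) ^ a := by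
      rw [← Real.rpow_natCast, ← Real.rpow_natCast, ← Real.rpow_mul (by positivity),
        ← Real.rpow_mul (by positivity), mul_comm]
    rw [hcomm]
    split_ifs with h
    · have h1 : 1 + δ * Real.log 2 ≤ (p : ℝ) ^ δ := by
        have h2 : (2 : ℝ) ^ δ ≤ (p : ℝ) ^ δ := Real.rpow_le_rpow (by norm_num) hp2 hδ.le
        have h3 : (2 : ℝ) ^ δ = Real.exp (δ * Real.log 2) := by
          rw [Real.rpow_def_of_pos two_pos, mul_comm]
        have := Real.add_one_le_exp (δ * Real.log 2)
        linarith
      have h4 : 1 + (a : ℝ) * (δ * Real.log 2) ≤ ((p : ℝ) ^ δ) ^ a :=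
        (one_add_mul_le_pow (by linarith) a).trans
          (pow_le_pow_left₀ (by positivity) h1 a)
      calc (a : ℝ) + 1 ≤ c * (1 + (a : ℝ) * (δ * Real.log 2)) := by
            rw [hc]
            have : (1 + 1 / (δ * Real.log 2)) * (1 + (a : ℝ) * (δ * Real.log 2))
              = 1 + a + a * (δ * Real.log 2) + 1 / (δ * Real.log 2) := by
              field_simp
              ring
            rw [this]
            have h5 := one_div_pos.mpr hl
            have h6 : 0 ≤ a * (δ * Real.log 2) := by positivity
            linarith
        _ ≤ _ := mul_le_mul_of_nonneg_left h4 (by linarith)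
    · have h1 : (2 : ℝ) ≤ (p : ℝ) ^ δ := by
        have hmp : (m : ℝ) ≤ p := by exact_mod_cast not_lt.mp h
        calc (2 : ℝ) = ((2 : ℝ) ^ (1 / δ)) ^ δ := by
              rw [← Real.rpow_mul (by norm_num), one_div_mul_cancel hδ.ne', Real.rpow_one]
          _ ≤ _ := Real.rpow_le_rpow (by positivity) (hm.trans hmp) hδ.le
      rw [one_mul]
      have h2 : (a : ℝ) + 1 ≤ 2 ^ a := by exact_mod_cast Nat.lt_two_pow_self (n := a)
      exact h2.trans (pow_le_pow_left₀ (by norm_num) h1 a)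
  refine ⟨c ^ m, one_le_pow₀ hc1, fun n hn => ?_⟩
  have hn' : (n : ℝ) ^ δ = ∏ p ∈ n.primeFactors, ((p : ℝ) ^ n.factorization p) ^ δ := by
    rw [Real.finsetProd_rpow _ _ (fun i _ => by positivity)]
    congr 1
    conv_lhs => rw [← Nat.prod_factorization_pow_eq_self hn]
    simp [Finsupp.prod]
  rw [Nat.card_divisors hn, hn']
  push_cast
  calc ∏ p ∈ n.primeFactors, ((n.factorization p : ℝ) + 1)
      ≤ ∏ p ∈ n.primeFactors,
          ((if p < m then c else 1) * ((p : ℝ) ^ n.factorization p) ^ δ) :=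
        Finset.prod_le_prod (fun _ _ => by positivity)
          (fun p hp => hlocal p (Nat.prime_of_mem_primeFactors hp) _)
    _ = (∏ p ∈ n.primeFactors, if p < m then c else 1) *
          ∏ p ∈ n.primeFactors, ((p : ℝ) ^ n.factorization p) ^ δ := Finset.prod_mul_distrib
    _ ≤ _ := by
        refine mul_le_mul_of_nonneg_right ?_ (Finset.prod_nonneg fun _ _ => by positivity)
        rw [Finset.prod_ite, Finset.prod_const, Finset.prod_const_one, mul_one]
        refine pow_le_pow_right₀ hc1 ?_
        calc _ ≤ (Finset.range m).card := Finset.card_le_card fun p hp => by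
              simpa using (Finset.mem_filter.mp hp).2
          _ = m := Finset.card_range m
theorem even_of_sq_sub_mul_sq_eq_four {D U₁ V₁ U₂ V₂ : ℤ} (h₁ : U₁ ^ 2 - D * V₁ ^ 2 = 4)
    (h₂ : U₂ ^ 2 - D * V₂ ^ 2 = 4) :
    Even (U₁ * U₂ - D * V₁ * V₂) ∧ Even (U₁ * V₂ - U₂ * V₁) := by
  have e₁ : Even (U₁ ^ 2 - D * V₁ ^ 2) := by rw [h₁]; decide
  have e₂ : Even (U₂ ^ 2 - D * V₂ ^ 2) := by rw [h₂]; decide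
  simp only [Int.even_sub, Int.even_mul, Int.even_pow] at *
  tauto

theorem two_mul_le_of_sq_sub_mul_sq_eq_four {D U₁ V₁ U₂ V₂ : ℤ} (hD : D ≠ 0)
    (h₁ : U₁ ^ 2 - D * V₁ ^ 2 = 4) (h₂ : U₂ ^ 2 - D * V₂ ^ 2 = 4)
    (hV₁ : 0 < V₁) (hV : V₁ < V₂) : 2 * V₁ ≤ V₂ := by
  wlog hU₁ : 0 ≤ U₁ generalizing U₁
  · exact this (U₁ := -U₁) (by linarith [neg_sq U₁]) (by linarith)
  wlog hU₂ : 0 ≤ U₂ generalizing U₂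
  · exact this (U₂ := -U₂) (by linarith [neg_sq U₂]) (by linarith)
  rcases lt_or_gt_of_ne hD with hD | hD
  · have : V₂ < 3 := by nlinarith [sq_nonneg U₂]
    omega
  · obtain ⟨⟨U, hU⟩, ⟨V, hV'⟩⟩ := even_of_sq_sub_mul_sq_eq_four h₁ h₂
    have hUV : U ^ 2 - D * V ^ 2 = 4 := by
      have : (U + U) ^ 2 - D * (V + V) ^ 2 = 4 * 4 := by
        rw [← hU, ← hV']
        linear_combination (U₂ ^ 2 - D * V₂ ^ 2) * h₁ + 4 * h₂
      linarith
    have h2V₂ : 2 * V₂ = U * V₁ + V * U₁ := by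
      have : 2 * (2 * V₂) = (U + U) * V₁ + (V + V) * U₁ := by
        rw [← hU, ← hV']
        linear_combination -V₂ * h₁
      linarith
    have hU₁V₁ : V₁ < U₁ := by nlinarith [sq_nonneg V₁]
    have hVpos : 0 < V := by
      by_contra hcon
      have : U₁ * V₂ ≤ U₂ * V₁ := by linarith
      have h3 : (U₁ * V₂) ^ 2 ≤ (U₂ * V₁) ^ 2 := by
        have : 0 ≤ U₁ * V₂ := mul_nonneg hU₁ (by linarith)
        gcongr
      nlinarith
    have hUpos : 0 < U := by
      by_contra hcon
      have h3 : U₁ * U₂ ≤ D * V₁ * V₂ := by linarith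
      have h4 : (U₁ * U₂) ^ 2 ≤ (D * V₁ * V₂) ^ 2 := by
        have : 0 ≤ U₁ * U₂ := mul_nonneg hU₁ hU₂
        gcongr
      have h5 : U₁ ^ 2 * U₂ ^ 2 = (4 + D * V₁ ^ 2) * (4 + D * V₂ ^ 2) := by
        rw [← sub_eq_iff_eq_add.mp h₁, ← sub_eq_iff_eq_add.mp h₂]
      have h6 : 0 ≤ D * V₁ ^ 2 := by positivity
      have h7 : 0 ≤ D * V₂ ^ 2 := by positivity
      nlinarith
    have hU3 : 3 ≤ U := by
      by_contra hcon
      have : 0 < D * V ^ 2 := by positivity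
      nlinarith
    nlinarith

theorem card_sq_sub_mul_sq_eq_four_le {D : ℤ} (hD : D ≠ 0) (B : ℕ) :
    ((Finset.Icc (-B : ℤ) B ×ˢ Finset.Icc (-B : ℤ) B).filter
      fun q => q.1 ^ 2 - D * q.2 ^ 2 = 4).card ≤ 4 * (Nat.log 2 B + 2) := by
  classical
  set S := (Finset.Icc (-B : ℤ) B ×ˢ Finset.Icc (-B : ℤ) B).filter
      fun q => q.1 ^ 2 - D * q.2 ^ 2 = 4 with hS
  set T : Finset (Bool × Bool × ℕ) :=
    Finset.univ ×ˢ Finset.univ ×ˢ Finset.range (Nat.log 2 B + 2) with hT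
  have hTcard : T.card = 4 * (Nat.log 2 B + 2) := by
    simp only [hT, Finset.card_product, Finset.card_univ, Fintype.card_bool, Finset.card_range]
    ring
  rw [← hTcard]
  have key : ∀ U₁ V₁ U₂ V₂ : ℤ, U₁ ^ 2 - D * V₁ ^ 2 = 4 → U₂ ^ 2 - D * V₂ ^ 2 = 4 →
      V₁ ≠ 0 → Nat.log 2 V₁.natAbs = Nat.log 2 V₂.natAbs → ¬ V₁.natAbs < V₂.natAbs := by
    intro U₁ V₁ U₂ V₂ h₁ h₂ h0 hlog hlt
    have h3 := two_mul_le_of_sq_sub_mul_sq_eq_four hD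
      (U₁ := U₁) (V₁ := V₁.natAbs) (U₂ := U₂) (V₂ := V₂.natAbs)
      (by rwa [Int.natAbs_sq]) (by rwa [Int.natAbs_sq]) (by omega) (by omega)
    have h4 : V₁.natAbs * 2 ≤ V₂.natAbs := by omega
    have h5 := Nat.log_mono_right (b := 2) h4
    rw [Nat.log_mul_base (by norm_num) (by omega)] at h5
    omega
  refine Finset.card_le_card_of_injOn
    (fun q => (decide (0 < q.1), decide (0 < q.2),
      if q.2 = 0 then 0 else Nat.log 2 q.2.natAbs + 1)) ?_ ?_
  · rintro ⟨U, V⟩ hq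
    simp only [hS, Finset.coe_filter, Finset.mem_product, Finset.mem_Icc, Set.mem_ofPred_eq] at hq
    simp only [hT, Finset.mem_coe, Finset.mem_product, Finset.mem_univ, Finset.mem_range, true_and]
    split_ifs
    · omega
    · have := Nat.log_mono_right (b := 2) (show V.natAbs ≤ B by omega)
      omega
  · rintro ⟨U₁, V₁⟩ hq₁ ⟨U₂, V₂⟩ hq₂ heq
    simp only [hS, Finset.coe_filter, Set.mem_ofPred_eq] at hq₁ hq₂
    simp only [Prod.mk.injEq, decide_eq_decide] at heq
    obtain ⟨hsU, hsV, hlog⟩ := heq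
    have hVV : V₁ = V₂ := by
      by_cases hz₁ : V₁ = 0 <;> by_cases hz₂ : V₂ = 0
      · rw [hz₁, hz₂]
      · simp [hz₁, hz₂] at hlog
      · simp [hz₁, hz₂] at hlog
      · simp only [hz₁, hz₂, if_false] at hlog
        have k₁ := key U₁ V₁ U₂ V₂ hq₁.2 hq₂.2 hz₁ (by omega)
        have k₂ := key U₂ V₂ U₁ V₁ hq₂.2 hq₁.2 hz₂ (by omega)
        omega
    have hUU : U₁ = U₂ := by
      have h3 : U₁ ^ 2 = U₂ ^ 2 := by
        have := hq₁.2; have := hq₂.2; rw [hVV] at *; linarith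
      rcases sq_eq_sq_iff_eq_or_eq_neg.mp h3 with h | h <;> omega
    rw [hVV, hUU]

theorem exists_quotient_sq_sub_mul_sq_eq_four {D N x₀ y₀ d e : ℤ} (hN : N ≠ 0)
    (h₀ : x₀ ^ 2 - D * y₀ ^ 2 = N) (hc₀ : IsCoprime x₀ y₀) (hde : N = d * e)
    {x₁ y₁ x₂ y₂ : ℤ} (h₁ : x₁ ^ 2 - D * y₁ ^ 2 = N) (h₂ : x₂ ^ 2 - D * y₂ ^ 2 = N)
    (hc₁ : IsCoprime x₁ y₁)
    (hd₁ : (Int.gcd N (x₁ * y₀ - x₀ * y₁) : ℤ) = d)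
    (hd₂ : (Int.gcd N (x₂ * y₀ - x₀ * y₂) : ℤ) = d) :
    (Int.gcd d e : ℤ) ^ 2 ∣ 4 * D ∧ N ∣ 2 * (x₁ * x₂ - D * y₁ * y₂) ∧
      N ∣ (Int.gcd d e : ℤ) * (x₁ * y₂ - x₂ * y₁) := by
  have hcop : ∀ x y : ℤ, x ^ 2 - D * y ^ 2 = N → IsCoprime x y → IsCoprime N y := by
    intro x y h hc
    have h1 : IsCoprime (x ^ 2 + y * (-(D * y))) y := (hc.pow_left (m := 2)).add_mul_left_left _
    rw [← h]
    convert h1 using 1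
    ring
  have hN₀ := hcop _ _ h₀ hc₀
  have hN₁ := hcop _ _ h₁ hc₁
  have hd0 : d ≠ 0 := by rintro rfl; simp at hde; exact hN hde
  have he0 : e ≠ 0 := by rintro rfl; simp at hde; exact hN hde
  have hplus : ∀ x y : ℤ, x ^ 2 - D * y ^ 2 = N → (Int.gcd N (x * y₀ - x₀ * y) : ℤ) = d →
      d ∣ x * y₀ - x₀ * y ∧ e ∣ x * y₀ + x₀ * y := by
    intro x y h hd
    refine ⟨hd ▸ Int.gcd_dvd_right _ _, ?_⟩
    have hb := Int.gcd_eq_gcd_ab N (x * y₀ - x₀ * y)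
    rw [hd] at hb
    set a := Int.gcdA N (x * y₀ - x₀ * y)
    set b := Int.gcdB N (x * y₀ - x₀ * y)
    refine Int.dvd_of_mul_dvd_mul_left (a := d) hd0 ?_
    rw [← hde]
    refine ⟨a * (x * y₀ + x₀ * y) + b * (y₀ ^ 2 - y ^ 2), ?_⟩
    linear_combination (x * y₀ + x₀ * y) * hb + b * y₀ ^ 2 * h - b * y ^ 2 * h₀
  obtain ⟨a₁, b₁⟩ := hplus x₁ y₁ h₁ hd₁
  obtain ⟨a₂, b₂⟩ := hplus x₂ y₂ h₂ hd₂
  set w := x₁ * y₂ - x₂ * y₁ with hw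
  set p := x₁ * x₂ - D * y₁ * y₂ with hp
  have hdw : d ∣ w := by
    have hdN : d ∣ N := ⟨e, hde⟩
    refine (hN₀.of_isCoprime_of_dvd_left hdN).dvd_of_dvd_mul_left (y := y₀) ?_
    have : y₀ * w = y₂ * (x₁ * y₀ - x₀ * y₁) - y₁ * (x₂ * y₀ - x₀ * y₂) := by rw [hw]; ring
    rw [this]
    exact dvd_sub (a₁.mul_left _) (a₂.mul_left _)
  have hew : e ∣ w := by
    have heN : e ∣ N := ⟨d, by rw [hde, mul_comm]⟩
    refine (hN₀.of_isCoprime_of_dvd_left heN).dvd_of_dvd_mul_left (y := y₀) ?_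
    have : y₀ * w = y₂ * (x₁ * y₀ + x₀ * y₁) - y₁ * (x₂ * y₀ + x₀ * y₂) := by rw [hw]; ring
    rw [this]
    exact dvd_sub (b₁.mul_left _) (b₂.mul_left _)
  have hGab := Int.gcd_eq_gcd_ab d e
  have hGd : (Int.gcd d e : ℤ) ∣ d := Int.gcd_dvd_left _ _
  have hGe : (Int.gcd d e : ℤ) ∣ e := Int.gcd_dvd_right _ _
  set G : ℤ := (Int.gcd d e : ℤ) with hG
  have hG2N : G ^ 2 ∣ N := by rw [hde, sq]; exact mul_dvd_mul hGd hGe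
  have hGN : G ∣ N := (dvd_pow_self G two_ne_zero).trans hG2N
  have hG0 : G ≠ 0 := by rintro h; rw [h] at hGN; exact hN (zero_dvd_iff.mp hGN)
  have hGD : G ^ 2 ∣ 4 * D := by
    have h2x : G ∣ 2 * x₀ := by
      refine (hN₁.of_isCoprime_of_dvd_left hGN).dvd_of_dvd_mul_right (z := y₁) ?_
      have : 2 * x₀ * y₁ = (x₁ * y₀ + x₀ * y₁) - (x₁ * y₀ - x₀ * y₁) := by ring
      rw [this]
      exact dvd_sub (hGe.trans b₁) (hGd.trans a₁)
    refine ((hN₀.pow_right (n := 2)).of_isCoprime_of_dvd_left hG2N).dvd_of_dvd_mul_right ?_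
    have : 4 * D * y₀ ^ 2 = (2 * x₀) ^ 2 - 4 * N := by rw [← h₀]; ring
    rw [this]
    exact dvd_sub (pow_dvd_pow_of_dvd h2x 2) (hG2N.mul_left _)
  have hNGw : N ∣ G * w := by
    rw [hGab, add_mul, hde]
    refine dvd_add ?_ ?_
    · rw [mul_assoc]; exact mul_dvd_mul_left d (hew.mul_left _)
    · rw [mul_assoc, mul_comm d e]; exact mul_dvd_mul_left e (hdw.mul_left _)
  refine ⟨hGD, ?_, hNGw⟩
  obtain ⟨E, hE⟩ := hGD
  obtain ⟨k, hk⟩ := hNGw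
  have : N ^ 2 ∣ (2 * p) ^ 2 := by
    refine ⟨4 + E * k ^ 2, ?_⟩
    have h3 : p ^ 2 - D * w ^ 2 = N ^ 2 := by
      rw [hp, hw]
      linear_combination (x₂ ^ 2 - D * y₂ ^ 2) * h₁ + N * h₂
    linear_combination 4 * h3 + w ^ 2 * hE + E * (G * w + N * k) * hk
  exact (Int.pow_dvd_pow_iff two_ne_zero).mp this

theorem card_isCoprime_sq_sub_mul_sq_eq_le {D N : ℤ} (hD : D ≠ 0) (hN : N ≠ 0) (B : ℕ) :
    ((Finset.Icc (-B : ℤ) B ×ˢ Finset.Icc (-B : ℤ) B).filter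
      fun q => q.1 ^ 2 - D * q.2 ^ 2 = N ∧ IsCoprime q.1 q.2).card ≤
      4 * (Nat.log 2 (2 * B ^ 2 * (1 + D.natAbs)) + 2) * N.natAbs.divisors.card := by
  classical
  set S := (Finset.Icc (-B : ℤ) B ×ˢ Finset.Icc (-B : ℤ) B).filter
      fun q => q.1 ^ 2 - D * q.2 ^ 2 = N ∧ IsCoprime q.1 q.2 with hS
  rcases S.eq_empty_or_nonempty with hE | ⟨⟨x₀, y₀⟩, hq₀⟩
  · simp [hE]
  have hmem : ∀ x y : ℤ, (x, y) ∈ S ↔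
      (|x| ≤ B ∧ |y| ≤ B) ∧ x ^ 2 - D * y ^ 2 = N ∧ IsCoprime x y := by
    intro x y
    simp only [hS, Finset.mem_filter, Finset.mem_product, Finset.mem_Icc, abs_le]
  refine Finset.card_le_mul_card_image_of_maps_to
    (f := fun q : ℤ × ℤ => Int.gcd N (q.1 * y₀ - x₀ * q.2)) ?_ _ ?_
  · intro q _
    exact Nat.mem_divisors.mpr ⟨Int.natCast_dvd.mp (Int.gcd_dvd_left _ _), by simpa using hN⟩
  intro d hd
  rcases (S.filter fun q => Int.gcd N (q.1 * y₀ - x₀ * q.2) = d).eq_empty_or_nonempty with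
    hE | ⟨⟨x₁, y₁⟩, hq₁⟩
  · simp [hE]
  obtain ⟨e, he⟩ : (d : ℤ) ∣ N := Int.natCast_dvd.mpr (Nat.dvd_of_mem_divisors hd)
  obtain ⟨hx₁, hd₁⟩ := Finset.mem_filter.mp hq₁
  obtain ⟨⟨hxb₁, hyb₁⟩, h₁, hc₁⟩ := (hmem _ _).mp hx₁
  obtain ⟨-, h₀, hc₀⟩ := (hmem _ _).mp hq₀
  have key := fun (x₂ y₂ : ℤ) (h₂ : x₂ ^ 2 - D * y₂ ^ 2 = N)
      (hd₂ : (Int.gcd N (x₂ * y₀ - x₀ * y₂) : ℤ) = d) =>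
    exists_quotient_sq_sub_mul_sq_eq_four hN h₀ hc₀ he h₁ h₂ hc₁ (by exact_mod_cast hd₁) hd₂
  obtain ⟨⟨E, hE⟩, -, -⟩ := key x₁ y₁ h₁ (by exact_mod_cast hd₁)
  have hE0 : E ≠ 0 := by
    rintro rfl
    simp only [mul_zero, mul_eq_zero] at hE
    omega
  have hGN : |(Int.gcd d e : ℤ)| ≤ |N| := by
    have h : (Int.gcd d e : ℤ) ∣ N := he ▸ (Int.gcd_dvd_left _ _).mul_right _
    have := Int.natAbs_le_of_dvd_ne_zero h hN
    rw [Int.abs_eq_natAbs, Int.abs_eq_natAbs]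
    exact_mod_cast this
  have hG0 : (Int.gcd d e : ℤ) ≠ 0 := by
    intro h
    rw [h, zero_pow two_ne_zero, zero_mul] at hE
    omega
  set G : ℤ := (Int.gcd d e : ℤ) with hG
  have hN1 : 0 < |N| := abs_pos.mpr hN
  refine le_trans (Finset.card_le_card_of_injOn
    (fun q : ℤ × ℤ => (2 * (x₁ * q.1 - D * y₁ * q.2) / N, G * (x₁ * q.2 - q.1 * y₁) / N))
    ?_ ?_) (card_sq_sub_mul_sq_eq_four_le hE0 _)
  · rintro ⟨x₂, y₂⟩ hq₂
    obtain ⟨hx₂, hd₂⟩ := Finset.mem_filter.mp (Finset.mem_coe.mp hq₂)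
    obtain ⟨⟨hxb₂, hyb₂⟩, h₂, hc₂⟩ := (hmem _ _).mp hx₂
    obtain ⟨-, ⟨U, hU⟩, ⟨V, hV⟩⟩ := key x₂ y₂ h₂ (by exact_mod_cast hd₂)
    simp only [Finset.mem_coe, Finset.mem_filter, Finset.mem_product, Finset.mem_Icc, ← abs_le]
    rw [hU, hV, Int.mul_ediv_cancel_left _ hN, Int.mul_ediv_cancel_left _ hN]
    have hBB : ∀ a b : ℤ, |a| ≤ B → |b| ≤ B → |a * b| ≤ (B : ℤ) ^ 2 := by
      intro a b ha hb
      rw [abs_mul, sq]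
      exact mul_le_mul ha hb (abs_nonneg _) (by positivity)
    have h11 := hBB _ _ hxb₁ hxb₂
    have h12 := hBB _ _ hxb₁ hyb₂
    have h21 := hBB _ _ hxb₂ hyb₁
    have h22 := hBB _ _ hyb₁ hyb₂
    have hB0 : (0 : ℤ) ≤ (B : ℤ) ^ 2 := by positivity
    have hD0 := abs_nonneg D
    refine ⟨⟨?_, ?_⟩, ?_⟩
    · calc |U| ≤ |N| * |U| := le_mul_of_one_le_left (abs_nonneg _) hN1
        _ = |2 * (x₁ * x₂ - D * (y₁ * y₂))| := by rw [← abs_mul, ← hU]; ring_nf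
        _ ≤ 2 * ((B : ℤ) ^ 2 + |D| * (B : ℤ) ^ 2) := by
            rw [abs_mul, abs_two]
            have h3 := abs_sub (x₁ * x₂) (D * (y₁ * y₂))
            rw [abs_mul D] at h3
            have h4 := mul_le_mul_of_nonneg_left h22 hD0
            linarith
        _ = _ := by push_cast; ring
    · have h3 : |N| * |V| ≤ |N| * (2 * (B : ℤ) ^ 2) := by
        calc |N| * |V| = |G| * |x₁ * y₂ - x₂ * y₁| := by rw [← abs_mul, ← hV, abs_mul]
          _ ≤ |N| * (2 * (B : ℤ) ^ 2) := by
            refine mul_le_mul hGN ?_ (abs_nonneg _) (abs_nonneg _)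
            have h3 := abs_sub (x₁ * y₂) (x₂ * y₁)
            linarith
      have h4 := le_of_mul_le_mul_left h3 hN1
      push_cast
      nlinarith
    · have h3 : (x₁ * x₂ - D * y₁ * y₂) ^ 2 - D * (x₁ * y₂ - x₂ * y₁) ^ 2 = N ^ 2 := by
        linear_combination (x₂ ^ 2 - D * y₂ ^ 2) * h₁ + N * h₂
      have h4 : N ^ 2 * (U ^ 2 - E * V ^ 2) = N ^ 2 * 4 := by
        linear_combination 4 * h3 + (x₁ * y₂ - x₂ * y₁) ^ 2 * hE -
          (2 * (x₁ * x₂ - D * y₁ * y₂) + N * U) * hU +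
          E * (G * (x₁ * y₂ - x₂ * y₁) + N * V) * hV
      exact mul_left_cancel₀ (pow_ne_zero 2 hN) h4
  · rintro ⟨x₂, y₂⟩ hq₂ ⟨x₃, y₃⟩ hq₃ heq
    obtain ⟨hx₂, hd₂⟩ := Finset.mem_filter.mp (Finset.mem_coe.mp hq₂)
    obtain ⟨hx₃, hd₃⟩ := Finset.mem_filter.mp (Finset.mem_coe.mp hq₃)
    obtain ⟨-, h₂, -⟩ := (hmem _ _).mp hx₂
    obtain ⟨-, h₃, -⟩ := (hmem _ _).mp hx₃
    obtain ⟨-, ⟨U, hU⟩, ⟨V, hV⟩⟩ := key x₂ y₂ h₂ (by exact_mod_cast hd₂)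
    obtain ⟨-, ⟨U', hU'⟩, ⟨V', hV'⟩⟩ := key x₃ y₃ h₃ (by exact_mod_cast hd₃)
    simp only [Prod.mk.injEq] at heq
    rw [hU, hV, hU', hV', Int.mul_ediv_cancel_left _ hN, Int.mul_ediv_cancel_left _ hN,
      Int.mul_ediv_cancel_left _ hN, Int.mul_ediv_cancel_left _ hN] at heq
    rw [heq.1, ← hU'] at hU
    rw [heq.2, ← hV'] at hV
    have hp := mul_left_cancel₀ two_ne_zero hU
    have hw := mul_left_cancel₀ hG0 hV
    have hx : N * x₂ = N * x₃ := by
      linear_combination (x₃ - x₂) * h₁ + x₁ * hp + D * y₁ * hw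
    have hy : N * y₂ = N * y₃ := by
      linear_combination (y₃ - y₂) * h₁ + x₁ * hw + y₁ * hp
    rw [mul_left_cancel₀ hN hx, mul_left_cancel₀ hN hy]

theorem card_sq_sub_mul_sq_eq_le {D N : ℤ} (hD : D ≠ 0) (hN : N ≠ 0) (B : ℕ) :
    ((Finset.Icc (-B : ℤ) B ×ˢ Finset.Icc (-B : ℤ) B).filter
      fun q => q.1 ^ 2 - D * q.2 ^ 2 = N).card ≤
      4 * (Nat.log 2 (2 * B ^ 2 * (1 + D.natAbs)) + 2) * N.natAbs.divisors.card *
        N.natAbs.divisors.card := by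
  classical
  have hN' : N.natAbs ≠ 0 := by simpa using hN
  have hg : ∀ x y : ℤ, x ^ 2 - D * y ^ 2 = N → (Int.gcd x y : ℤ) ^ 2 ∣ N := by
    intro x y h
    rw [← h]
    exact dvd_sub (pow_dvd_pow_of_dvd (Int.gcd_dvd_left _ _) 2)
      ((pow_dvd_pow_of_dvd (Int.gcd_dvd_right _ _) 2).mul_left _)
  refine Finset.card_le_mul_card_image_of_maps_to
    (f := fun q : ℤ × ℤ => Int.gcd q.1 q.2) ?_ _ ?_
  · rintro ⟨x, y⟩ hq
    have h := (Finset.mem_filter.mp (Finset.mem_coe.mp hq)).2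
    exact Nat.mem_divisors.mpr ⟨Int.natCast_dvd.mp
      ((dvd_pow_self _ two_ne_zero).trans (hg x y h)), hN'⟩
  intro g hgdiv
  by_cases hgN : (g : ℤ) ^ 2 ∣ N
  swap
  · rw [Finset.card_eq_zero.mpr]
    · exact Nat.zero_le _
    · refine Finset.filter_eq_empty_iff.mpr ?_
      rintro ⟨x, y⟩ hq rfl
      exact hgN (hg x y (Finset.mem_filter.mp hq).2)
  obtain ⟨M, hM⟩ := hgN
  have hM0 : M ≠ 0 := by rintro rfl; simp at hM; exact hN hM
  have hg0 : g ≠ 0 := (Nat.pos_of_mem_divisors hgdiv).ne'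
  have hg0' : (g : ℤ) ≠ 0 := by exact_mod_cast hg0
  refine le_trans (Finset.card_le_card_of_injOn (fun q : ℤ × ℤ => (q.1 / g, q.2 / g)) ?_ ?_)
    ((card_isCoprime_sq_sub_mul_sq_eq_le hD hM0 B).trans ?_)
  · rintro ⟨x, y⟩ hq
    simp only [Finset.coe_filter, Finset.mem_filter, Finset.mem_product, Finset.mem_Icc,
      Set.mem_ofPred_eq, ← abs_le] at hq ⊢
    obtain ⟨⟨⟨hx, hy⟩, h⟩, hgcd⟩ := hq
    have hgx : (g : ℤ) ∣ x := hgcd ▸ Int.gcd_dvd_left _ _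
    have hgy : (g : ℤ) ∣ y := hgcd ▸ Int.gcd_dvd_right _ _
    refine ⟨⟨?_, ?_⟩, ?_, ?_⟩
    · exact le_trans (by
        rw [Int.abs_eq_natAbs, Int.abs_eq_natAbs]
        exact_mod_cast Int.natAbs_ediv_le_natAbs x g) hx
    · exact le_trans (by
        rw [Int.abs_eq_natAbs, Int.abs_eq_natAbs]
        exact_mod_cast Int.natAbs_ediv_le_natAbs y g) hy
    · obtain ⟨x', rfl⟩ := hgx
      obtain ⟨y', rfl⟩ := hgy
      rw [Int.mul_ediv_cancel_left _ hg0', Int.mul_ediv_cancel_left _ hg0']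
      refine mul_left_cancel₀ (pow_ne_zero 2 hg0') ?_
      rw [← hM, ← h]
      ring
    · rw [Int.isCoprime_iff_gcd_eq_one, ← hgcd]
      exact Int.gcd_ediv_gcd_ediv_gcd (by omega)
  · rintro ⟨x, y⟩ hq ⟨x', y'⟩ hq' heq
    have h := (Finset.mem_filter.mp (Finset.mem_coe.mp hq)).2
    have h' := (Finset.mem_filter.mp (Finset.mem_coe.mp hq')).2
    simp only [Prod.mk.injEq] at heq h h'
    have hgx : (g : ℤ) ∣ x := h ▸ Int.gcd_dvd_left _ _
    have hgy : (g : ℤ) ∣ y := h ▸ Int.gcd_dvd_right _ _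
    have hgx' : (g : ℤ) ∣ x' := h' ▸ Int.gcd_dvd_left _ _
    have hgy' : (g : ℤ) ∣ y' := h' ▸ Int.gcd_dvd_right _ _
    rw [Int.ediv_left_inj hgx hgx', Int.ediv_left_inj hgy hgy'] at heq
    rw [heq.1, heq.2]
  · refine Nat.mul_le_mul_left _ (Finset.card_le_card (Nat.divisors_subset_of_dvd hN' ?_))
    exact Int.natAbs_dvd_natAbs.mpr ⟨_, by rw [hM, mul_comm]⟩

theorem exists_card_sq_sub_mul_sq_eq_le_rpow (δ : ℝ) (hδ : 0 < δ) :
    ∃ K : ℝ, 0 ≤ K ∧ ∀ R : ℕ, 2 ≤ R → ∀ D N : ℤ, D ≠ 0 → N ≠ 0 → D.natAbs ≤ R → N.natAbs ≤ R →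
      (((Finset.Icc (-R : ℤ) R ×ˢ Finset.Icc (-R : ℤ) R).filter
        fun q => q.1 ^ 2 - D * q.2 ^ 2 = N).card : ℝ) ≤ K * (R : ℝ) ^ δ := by
  obtain ⟨K, hK1, hK⟩ := Nat.exists_card_divisors_le_rpow (δ / 3) (by positivity)
  have hl2 : 0 < Real.log 2 := Real.log_pos one_lt_two
  refine ⟨4 * (5 / (δ / 3) / Real.log 2 + 2) * K * K, by positivity,
    fun R hR D N hD hN hDR hNR => ?_⟩
  have hR0 : (0 : ℝ) < R := by positivity
  have hR1 : (1 : ℝ) ≤ R := by exact_mod_cast (by omega : 1 ≤ R)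
  have hpow1 : (1 : ℝ) ≤ (R : ℝ) ^ (δ / 3) := Real.one_le_rpow hR1 (by positivity)
  have hd : (N.natAbs.divisors.card : ℝ) ≤ K * (R : ℝ) ^ (δ / 3) := by
    refine (hK _ (by simpa using hN)).trans (mul_le_mul_of_nonneg_left ?_ (by linarith))
    exact Real.rpow_le_rpow (by positivity) (by exact_mod_cast hNR) (by positivity)
  have hlog : ((Nat.log 2 (2 * R ^ 2 * (1 + D.natAbs)) + 2 : ℕ) : ℝ) ≤
      (5 / (δ / 3) / Real.log 2 + 2) * (R : ℝ) ^ (δ / 3) := by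
    have h1 : 2 * R ^ 2 * (1 + D.natAbs) ≤ R ^ 5 := by
      calc 2 * R ^ 2 * (1 + D.natAbs) ≤ R * R ^ 2 * (R * R) := by
            gcongr
            nlinarith
        _ = R ^ 5 := by ring
    have h2 : ((Nat.log 2 (2 * R ^ 2 * (1 + D.natAbs)) : ℕ) : ℝ) ≤ 5 * Real.log R / Real.log 2 := by
      calc _ ≤ ((Nat.log 2 (R ^ 5) : ℕ) : ℝ) := by exact_mod_cast Nat.log_mono_right h1
        _ ≤ Real.logb 2 ((R ^ 5 : ℕ) : ℝ) := by exact_mod_cast Real.natLog_le_logb (R ^ 5) 2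
        _ = _ := by rw [Real.logb]; push_cast; rw [Real.log_pow]; norm_num
    have h3 := Real.log_le_rpow_div hR0.le (show 0 < δ / 3 by positivity)
    have h4 : 5 * Real.log R / Real.log 2 ≤ 5 / (δ / 3) / Real.log 2 * (R : ℝ) ^ (δ / 3) := by
      calc 5 * Real.log R / Real.log 2 ≤ 5 * ((R : ℝ) ^ (δ / 3) / (δ / 3)) / Real.log 2 := by gcongr
        _ = _ := by ring
    push_cast
    nlinarith
  calc _ ≤ ((4 * (Nat.log 2 (2 * R ^ 2 * (1 + D.natAbs)) + 2) * N.natAbs.divisors.card *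
        N.natAbs.divisors.card : ℕ) : ℝ) := by exact_mod_cast card_sq_sub_mul_sq_eq_le hD hN R
    _ = 4 * ((Nat.log 2 (2 * R ^ 2 * (1 + D.natAbs)) + 2 : ℕ) : ℝ) * N.natAbs.divisors.card *
        N.natAbs.divisors.card := by push_cast; ring
    _ ≤ 4 * ((5 / (δ / 3) / Real.log 2 + 2) * (R : ℝ) ^ (δ / 3)) * (K * (R : ℝ) ^ (δ / 3)) *
        (K * (R : ℝ) ^ (δ / 3)) := by gcongr
    _ = 4 * (5 / (δ / 3) / Real.log 2 + 2) * K * K *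
        ((R : ℝ) ^ (δ / 3) * (R : ℝ) ^ (δ / 3) * (R : ℝ) ^ (δ / 3)) := by ring
    _ = _ := by
        rw [← Real.rpow_add hR0, ← Real.rpow_add hR0]
        ring_nf

/-- The symmetric trilinear form attached to a family of coefficients: the sum over all
permutations of the arguments of `∑ t i j k xᵢ yⱼ zₖ`. -/
def symTrilinear {s : ℕ} (t : Fin s → Fin s → Fin s → ℤ) (x y z : Fin s → ℤ) : ℤ :=
  ∑ i, ∑ j, ∑ k, t i j k * (x i * y j * z k + x i * z j * y k + y i * x j * z k +
    y i * z j * x k + z i * x j * y k + z i * y j * x k)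

namespace symTrilinear

variable {s : ℕ} (t : Fin s → Fin s → Fin s → ℤ)

theorem swap_left (x y z : Fin s → ℤ) : symTrilinear t x y z = symTrilinear t y x z := by
  unfold symTrilinear
  refine Finset.sum_congr rfl fun i _ => Finset.sum_congr rfl fun j _ =>
    Finset.sum_congr rfl fun k _ => ?_
  ring

theorem swap_right (x y z : Fin s → ℤ) : symTrilinear t x y z = symTrilinear t x z y := by
  unfold symTrilinear
  refine Finset.sum_congr rfl fun i _ => Finset.sum_congr rfl fun j _ =>
    Finset.sum_congr rfl fun k _ => ?_
  ring

theorem add_left (x x' y z : Fin s → ℤ) :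
    symTrilinear t (x + x') y z = symTrilinear t x y z + symTrilinear t x' y z := by
  unfold symTrilinear
  simp only [← Finset.sum_add_distrib, Pi.add_apply]
  refine Finset.sum_congr rfl fun i _ => Finset.sum_congr rfl fun j _ =>
    Finset.sum_congr rfl fun k _ => ?_
  ring

theorem smul_left (a : ℤ) (x y z : Fin s → ℤ) :
    symTrilinear t (a • x) y z = a * symTrilinear t x y z := by
  unfold symTrilinear
  simp only [Finset.mul_sum, Pi.smul_apply, smul_eq_mul]
  refine Finset.sum_congr rfl fun i _ => Finset.sum_congr rfl fun j _ =>
    Finset.sum_congr rfl fun k _ => ?_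
  ring

theorem add_mid (x y y' z : Fin s → ℤ) :
    symTrilinear t x (y + y') z = symTrilinear t x y z + symTrilinear t x y' z := by
  rw [swap_left, add_left, swap_left t y, swap_left t y']

theorem smul_mid (a : ℤ) (x y z : Fin s → ℤ) :
    symTrilinear t x (a • y) z = a * symTrilinear t x y z := by
  rw [swap_left, smul_left, swap_left t y]

theorem add_right (x y z z' : Fin s → ℤ) :
    symTrilinear t x y (z + z') = symTrilinear t x y z + symTrilinear t x y z' := by
  rw [swap_right, add_mid, swap_right t x z, swap_right t x z']

theorem smul_right (a : ℤ) (x y z : Fin s → ℤ) :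
    symTrilinear t x y (a • z) = a * symTrilinear t x y z := by
  rw [swap_right, smul_mid, swap_right t x z]

theorem zero_mid (x z : Fin s → ℤ) : symTrilinear t x 0 z = 0 := by
  simpa using smul_mid t 0 x 0 z

theorem diag (x : Fin s → ℤ) :
    symTrilinear t x x x = 6 * ∑ i, ∑ j, ∑ k, t i j k * (x i * x j * x k) := by
  unfold symTrilinear
  simp only [Finset.mul_sum]
  refine Finset.sum_congr rfl fun i _ => Finset.sum_congr rfl fun j _ =>
    Finset.sum_congr rfl fun k _ => ?_
  ring

/-- The cubic difference `T(z+h) - T(z-h)`. -/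
theorem diag_add_sub_diag_sub (h z : Fin s → ℤ) :
    symTrilinear t (z + h) (z + h) (z + h) - symTrilinear t (z - h) (z - h) (z - h) =
      2 * (3 * symTrilinear t h z z + symTrilinear t h h h) := by
  have hneg : z - h = z + (-1 : ℤ) • h := by simp [sub_eq_add_neg]
  rw [hneg]
  simp only [add_left, add_mid, add_right, smul_left, smul_mid, smul_right]
  rw [swap_left t z h z, swap_right t z z h, swap_left t z h z, swap_right t h z h,
    swap_left t z h h]
  ring

theorem add_smul_add_smul (h w u v : Fin s → ℤ) (a b : ℤ) :
    3 * symTrilinear t h (w + a • u + b • v) (w + a • u + b • v) + symTrilinear t h h h =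
      3 * (symTrilinear t h u u * a ^ 2 + 2 * symTrilinear t h u v * a * b +
        symTrilinear t h v v * b ^ 2 + 2 * symTrilinear t h w u * a +
        2 * symTrilinear t h w v * b) +
      (3 * symTrilinear t h w w + symTrilinear t h h h) := by
  simp only [add_mid, add_right, smul_mid, smul_right]
  rw [swap_right t h u w, swap_right t h v w, swap_right t h v u]
  ring

theorem abs_le {x y z : Fin s → ℤ} {a b c : ℤ} (ha : 0 ≤ a) (hb : 0 ≤ b)
    (hx : ∀ i, |x i| ≤ a) (hy : ∀ i, |y i| ≤ b) (hz : ∀ i, |z i| ≤ c) :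
    |symTrilinear t x y z| ≤ (6 * ∑ i, ∑ j, ∑ k, |t i j k|) * (a * b * c) := by
  unfold symTrilinear
  simp only [Finset.mul_sum, Finset.sum_mul]
  refine le_trans (Finset.abs_sum_le_sum_abs _ _) (Finset.sum_le_sum fun i _ => ?_)
  refine le_trans (Finset.abs_sum_le_sum_abs _ _) (Finset.sum_le_sum fun j _ => ?_)
  refine le_trans (Finset.abs_sum_le_sum_abs _ _) (Finset.sum_le_sum fun k _ => ?_)
  have key : ∀ i j k, |x i * y j * z k| ≤ a * b * c := fun i j k => by
    rw [abs_mul, abs_mul]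
    exact mul_le_mul (mul_le_mul (hx i) (hy j) (abs_nonneg _) ha) (hz k) (abs_nonneg _)
      (mul_nonneg ha hb)
  rw [abs_mul, mul_comm 6 |t i j k|, mul_assoc |t i j k| 6]
  refine mul_le_mul_of_nonneg_left ?_ (abs_nonneg (t i j k))
  have h₁ := key i j k
  have h₂ := key i k j
  have h₃ := key j i k
  have h₄ := key k i j
  have h₅ := key j k i
  have h₆ := key k j i
  rw [_root_.abs_le] at *
  constructor <;> linarith

end symTrilinear

theorem MvPolynomial.IsHomogeneous.exists_eval_eq_sum {s : ℕ} {p : MvPolynomial (Fin s) ℤ}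
    (hp : p.IsHomogeneous 3) : ∃ t : Fin s → Fin s → Fin s → ℤ,
      ∀ x, eval x p = ∑ i, ∑ j, ∑ k, t i j k * (x i * x j * x k) := by
  classical
  have hmon : ∀ m ∈ p.support, ∃ i j k : Fin s, ∀ x : Fin s → ℤ,
      eval x (monomial m (p.coeff m)) = p.coeff m * (x i * x j * x k) := by
    intro m hm
    have hcard : Multiset.card (Finsupp.toMultiset m) = 3 := by
      rw [Finsupp.card_toMultiset, hp.degree_eq_sum_deg_support hm]
      rfl
    obtain ⟨i, j, k, hijk⟩ := Multiset.card_eq_three.mp hcard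
    refine ⟨i, j, k, fun x => ?_⟩
    rw [eval_monomial]
    congr 1
    have : (m.prod fun n e => x n ^ e) = ((Finsupp.toMultiset m).map x).prod := by
      rw [Finsupp.toMultiset_map, Finsupp.prod_toMultiset,
        Finsupp.prod_mapDomain_index (by simp) (by intros; rw [pow_add])]
    rw [this, hijk]
    simp [mul_assoc]
  have hsum : ∀ S : Finset (Fin s →₀ ℕ), S ⊆ p.support → ∃ t : Fin s → Fin s → Fin s → ℤ,
      ∀ x, eval x (∑ m ∈ S, monomial m (p.coeff m)) =
        ∑ i, ∑ j, ∑ k, t i j k * (x i * x j * x k) := by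
    intro S
    induction S using Finset.induction_on with
    | empty => exact fun _ => ⟨0, by simp⟩
    | insert m S hm ih =>
      intro hS
      obtain ⟨t, ht⟩ := ih ((Finset.subset_insert _ _).trans hS)
      obtain ⟨I, J, K, hIJK⟩ := hmon m (hS (Finset.mem_insert_self _ _))
      refine ⟨fun i j k => (if i = I ∧ j = J ∧ k = K then p.coeff m else 0) + t i j k,
        fun x => ?_⟩
      rw [Finset.sum_insert hm, map_add, hIJK, ht]
      simp only [add_mul, Finset.sum_add_distrib]
      congr 1
      rw [Finset.sum_eq_single I (fun b _ hb => by simp [hb]) (by simp),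
        Finset.sum_eq_single J (fun b _ hb => by simp [hb]) (by simp),
        Finset.sum_eq_single K (fun b _ hb => by simp [hb]) (by simp)]
      simp
  obtain ⟨t, ht⟩ := hsum p.support subset_rfl
  exact ⟨t, fun x => by rw [← ht, ← p.as_sum]⟩

/-- Integer functions given by a polynomial of total degree at most `d`. -/
def IsPolynomialFun {s : ℕ} (d : ℕ) (f : (Fin s → ℤ) → ℤ) : Prop :=
  ∃ p : MvPolynomial (Fin s) ℤ, p.totalDegree ≤ d ∧ ∀ x, eval x p = f x

namespace IsPolynomialFun

variable {s d e : ℕ} {f g : (Fin s → ℤ) → ℤ}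

theorem const (d : ℕ) (a : ℤ) : IsPolynomialFun d fun _ : Fin s → ℤ => a :=
  ⟨C a, by rw [totalDegree_C]; exact Nat.zero_le d, fun _ => eval_C a⟩

theorem coord (i : Fin s) : IsPolynomialFun 1 fun x : Fin s → ℤ => x i :=
  ⟨X i, by simp, by simp⟩

theorem mono (hf : IsPolynomialFun d f) (h : d ≤ e) : IsPolynomialFun e f := by
  obtain ⟨p, hp, hpf⟩ := hf
  exact ⟨p, hp.trans h, hpf⟩

theorem add (hf : IsPolynomialFun d f) (hg : IsPolynomialFun d g) :
    IsPolynomialFun d fun x => f x + g x := by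
  obtain ⟨p, hp, hpf⟩ := hf
  obtain ⟨q, hq, hqg⟩ := hg
  exact ⟨p + q, (totalDegree_add p q).trans (max_le hp hq), fun x => by rw [map_add, hpf, hqg]⟩

theorem mul (hf : IsPolynomialFun d f) (hg : IsPolynomialFun e g) :
    IsPolynomialFun (d + e) fun x => f x * g x := by
  obtain ⟨p, hp, hpf⟩ := hf
  obtain ⟨q, hq, hqg⟩ := hg
  exact ⟨p * q, (totalDegree_mul p q).trans (add_le_add hp hq), fun x => by
    rw [map_mul, hpf, hqg]⟩

theorem const_mul (a : ℤ) (hf : IsPolynomialFun d f) : IsPolynomialFun d fun x => a * f x :=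
  ((const 0 a).mul hf).mono (by omega)

theorem sub (hf : IsPolynomialFun d f) (hg : IsPolynomialFun d g) :
    IsPolynomialFun d fun x => f x - g x := by
  simpa [sub_eq_add_neg] using hf.add (hg.const_mul (-1))

theorem sum {ι : Type*} (S : Finset ι) {F : ι → (Fin s → ℤ) → ℤ}
    (hF : ∀ i, IsPolynomialFun d (F i)) : IsPolynomialFun d fun x => ∑ i ∈ S, F i x := by
  classical
  induction S using Finset.induction_on with
  | empty => simpa using const (s := s) d 0
  | insert a S ha ih => simpa only [Finset.sum_insert ha] using (hF a).add ih

theorem symTrilinear (t : Fin s → Fin s → Fin s → ℤ) {a b c : ℕ}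
    {X Y Z : (Fin s → ℤ) → Fin s → ℤ} (hX : ∀ i, IsPolynomialFun a fun x => X x i)
    (hY : ∀ i, IsPolynomialFun b fun x => Y x i) (hZ : ∀ i, IsPolynomialFun c fun x => Z x i) :
    IsPolynomialFun (a + b + c) fun x => symTrilinear t (X x) (Y x) (Z x) := by
  unfold _root_.symTrilinear
  refine sum _ fun i => sum _ fun j => sum _ fun k => const_mul _ ?_
  refine .add (.add (.add (.add (.add ?_ ?_) ?_) ?_) ?_) ?_
  · exact ((hX i).mul (hY j)).mul (hZ k)
  · exact (((hX i).mul (hZ j)).mul (hY k)).mono (by omega)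
  · exact (((hY i).mul (hX j)).mul (hZ k)).mono (by omega)
  · exact (((hY i).mul (hZ j)).mul (hX k)).mono (by omega)
  · exact (((hZ i).mul (hX j)).mul (hY k)).mono (by omega)
  · exact (((hZ i).mul (hY j)).mul (hX k)).mono (by omega)

theorem exists_mul_ne_zero (hf : IsPolynomialFun d f) (hg : IsPolynomialFun e g)
    (hf0 : ∃ x, f x ≠ 0) (hg0 : ∃ x, g x ≠ 0) : ∃ x, f x * g x ≠ 0 := by
  obtain ⟨p, -, hpf⟩ := hf
  obtain ⟨q, -, hqg⟩ := hg
  by_contra! hcon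
  have hpq : p * q = 0 := MvPolynomial.funext fun x => by rw [map_mul, hpf, hqg, hcon, map_zero]
  obtain ⟨x, hx⟩ := hf0
  obtain ⟨y, hy⟩ := hg0
  rcases mul_eq_zero.mp hpq with h | h
  · exact hx (by rw [← hpf, h, map_zero])
  · exact hy (by rw [← hqg, h, map_zero])

end IsPolynomialFun

/-- The integer points of the cube `[-Q, Q]^s`. -/
noncomputable def intBox (s Q : ℕ) : Finset (Fin s → ℤ) :=
  Fintype.piFinset fun _ => Finset.Icc (-Q : ℤ) Q

theorem mem_intBox {s Q : ℕ} {x : Fin s → ℤ} : x ∈ intBox s Q ↔ ∀ i, |x i| ≤ Q := by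
  simp [intBox, abs_le]

theorem card_intBox (s Q : ℕ) : (intBox s Q).card = (2 * Q + 1) ^ s := by
  have : ((Q : ℤ) + 1 + Q).toNat = 2 * Q + 1 := by omega
  simp [intBox, this]

theorem IsPolynomialFun.card_zeros_le {s d : ℕ} (hs : 1 ≤ s) {f : (Fin s → ℤ) → ℤ}
    (hf : IsPolynomialFun d f) (hf0 : ∃ x, f x ≠ 0) (Q : ℕ) :
    ((intBox s Q).filter fun x => f x = 0).card ≤ d * (2 * Q + 1) ^ (s - 1) := by
  obtain ⟨p, hp, hpf⟩ := hf
  obtain ⟨x, hx⟩ := hf0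
  have hp0 : p ≠ 0 := by rintro rfl; exact hx (by rw [← hpf, map_zero])
  have hsz := schwartz_zippel_totalDegree hp0 (Finset.Icc (-Q : ℤ) Q)
  have hc : (Finset.Icc (-Q : ℤ) Q).card = 2 * Q + 1 := by
    rw [Int.card_Icc]; omega
  simp only [hpf, hc] at hsz
  obtain ⟨n, rfl⟩ : ∃ n, s = n + 1 := ⟨s - 1, by omega⟩
  have hpos : (0 : ℚ≥0) < ((2 * Q + 1 : ℕ) : ℚ≥0) := by positivity
  rw [div_le_div_iff₀ (by positivity) hpos, pow_succ, ← mul_assoc] at hsz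
  have h2 := le_of_mul_le_mul_right hsz hpos
  have h3 : ((intBox (n + 1) Q).filter fun x => f x = 0).card ≤
      p.totalDegree * (2 * Q + 1) ^ n := by
    exact_mod_cast h2
  exact h3.trans (Nat.mul_le_mul_right _ hp)

theorem exists_discriminant_ne_zero {s : ℕ} {p : MvPolynomial (Fin s) ℤ}
    {t : Fin s → Fin s → Fin s → ℤ}
    (ht : ∀ x, symTrilinear t x x x = 6 * eval x p)
    (hdeg : ¬ ∃ (a : ℚ) (b : Fin s → ℚ), MvPolynomial.map (Int.castRingHom ℚ) p =
        MvPolynomial.C a * (∑ i, MvPolynomial.C (b i) * MvPolynomial.X i) ^ 3) :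
    ∃ u v h : Fin s → ℤ, symTrilinear t u u u ≠ 0 ∧
      symTrilinear t h u v ^ 2 - symTrilinear t h u u * symTrilinear t h v v ≠ 0 := by
  by_contra! hcon
  have hp0 : p ≠ 0 := by
    rintro rfl
    exact hdeg ⟨0, 0, by simp⟩
  obtain ⟨u, hu⟩ : ∃ u, eval u p ≠ 0 := by
    by_contra! h
    exact hp0 (MvPolynomial.funext fun x => by rw [h x, map_zero])
  set τ := symTrilinear t u u u with hτ
  have hτ0 : τ ≠ 0 := by rw [hτ, ht]; positivity
  set L : MvPolynomial (Fin s) ℤ := ∑ i, C (symTrilinear t u u (Pi.single i 1)) * X i with hL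
  have hLeval : ∀ x, eval x L = symTrilinear t u u x := by
    intro x
    let φ : (Fin s → ℤ) →+ ℤ :=
      AddMonoidHom.mk' (fun z => symTrilinear t u u z) fun a b => symTrilinear.add_right t u u a b
    have hφ : ∀ z, φ z = symTrilinear t u u z := fun _ => rfl
    have hx : x = ∑ i, x i • (Pi.single i 1 : Fin s → ℤ) := pi_eq_sum_univ' x
    conv_rhs => rw [hx, ← hφ, map_sum]
    rw [hL, map_sum]
    refine Finset.sum_congr rfl fun i _ => ?_
    rw [hφ, symTrilinear.smul_right, map_mul, eval_C, eval_X, mul_comm]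
  have hL0 : L ≠ 0 := by
    intro h
    apply hτ0
    rw [hτ, ← hLeval, h, map_zero]
  have hprod : L * (C (6 * τ ^ 2) * p - L ^ 3) = 0 := by
    refine MvPolynomial.funext fun v => ?_
    have h₁ := hcon u v u hτ0
    have h₂ := hcon u v v hτ0
    rw [symTrilinear.swap_left t v u v,
      symTrilinear.swap_left t v u u, symTrilinear.swap_right t u v u, ht v] at h₂
    rw [← hτ] at h₁
    rw [map_mul, map_sub, map_mul, map_pow _ L 3, eval_C, map_zero, hLeval]
    linear_combination (-τ ^ 2) * h₂ + (symTrilinear t u v v * τ + symTrilinear t u u v ^ 2) * -h₁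
  have hLp : C (6 * τ ^ 2) * p = L ^ 3 :=
    sub_eq_zero.mp ((mul_eq_zero.mp hprod).resolve_left hL0)
  refine hdeg ⟨1 / (6 * (τ : ℚ) ^ 2), fun i => (symTrilinear t u u (Pi.single i 1) : ℚ), ?_⟩
  have hmap := congrArg (MvPolynomial.map (Int.castRingHom ℚ)) hLp
  have hτQ : (6 * (τ : ℚ) ^ 2) ≠ 0 := by
    have : (τ : ℚ) ≠ 0 := by exact_mod_cast hτ0
    positivity
  have hLmap : MvPolynomial.map (Int.castRingHom ℚ) L =
      ∑ i, C (symTrilinear t u u (Pi.single i 1) : ℚ) * X i := by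
    simp [hL]
  rw [map_mul, map_pow _ L 3, hLmap] at hmap
  rw [← hmap, ← mul_assoc]
  have h6 : MvPolynomial.map (Int.castRingHom ℚ) (C (6 * τ ^ 2)) =
      (C (6 * (τ : ℚ) ^ 2) : MvPolynomial (Fin s) ℚ) := by
    rw [map_C]
    congr 1
    simp
  rw [h6, ← C_mul, one_div_mul_cancel hτQ, C_1, one_mul]

theorem card_quadratic_zeros_le {α β γ δ η φ : ℤ} (hα : α ≠ 0) (Q : ℕ) :
    ((Finset.Icc (1 : ℤ) Q ×ˢ Finset.Icc (1 : ℤ) Q).filter fun q =>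
      3 * (α * q.1 ^ 2 + 2 * β * q.1 * q.2 + γ * q.2 ^ 2 + 2 * δ * q.1 + 2 * η * q.2) + φ = 0).card
      ≤ 2 * Q := by
  classical
  have hQ : (Finset.Icc (1 : ℤ) Q).card = Q := by rw [Int.card_Icc]; omega
  conv_rhs => rw [← hQ]
  refine Finset.card_le_mul_card_image_of_maps_to (f := Prod.snd) ?_ _ ?_
  · intro q hq
    exact (Finset.mem_product.mp (Finset.mem_filter.mp (Finset.mem_coe.mp hq)).1).2
  intro b _
  by_contra! hcon
  obtain ⟨⟨a₁, b₁⟩, h₁, ⟨a₂, b₂⟩, h₂, ⟨a₃, b₃⟩, h₃, h₁₂, h₁₃, h₂₃⟩ := Finset.two_lt_card.mp hcon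
  simp only [Finset.mem_filter] at h₁ h₂ h₃
  obtain ⟨⟨-, e₁⟩, rfl⟩ := h₁
  obtain ⟨⟨-, e₂⟩, rfl⟩ := h₂
  obtain ⟨⟨-, e₃⟩, rfl⟩ := h₃
  have n₁₂ : a₁ - a₂ ≠ 0 := sub_ne_zero.mpr fun h => h₁₂ (by rw [h])
  have n₁₃ : a₁ - a₃ ≠ 0 := sub_ne_zero.mpr fun h => h₁₃ (by rw [h])
  have n₂₃ : a₂ - a₃ ≠ 0 := sub_ne_zero.mpr fun h => h₂₃ (by rw [h])
  have f₁₂ : α * (a₁ + a₂) + 2 * β * b₃ + 2 * δ = 0 := by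
    refine (mul_eq_zero.mp ?_).resolve_left n₁₂
    linarith
  have f₁₃ : α * (a₁ + a₃) + 2 * β * b₃ + 2 * δ = 0 := by
    refine (mul_eq_zero.mp ?_).resolve_left n₁₃
    linarith
  exact (mul_ne_zero hα n₂₃) (by linarith)

theorem card_quadratic_zeros_le_card_pell {α β γ δ η φ : ℤ} (hα : α ≠ 0)
    (hD : β ^ 2 - α * γ ≠ 0) {Q M : ℕ} (hM : 1 ≤ M) (hQM : Q ≤ M) (hαM : |α| ≤ M) (hβM : |β| ≤ M)
    (hγM : |γ| ≤ M) (hδM : |δ| ≤ M) (hηM : |η| ≤ M) :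
    ((Finset.Icc (1 : ℤ) Q ×ˢ Finset.Icc (1 : ℤ) Q).filter fun q =>
      3 * (α * q.1 ^ 2 + 2 * β * q.1 * q.2 + γ * q.2 ^ 2 + 2 * δ * q.1 + 2 * η * q.2) + φ = 0).card
      ≤ ((Finset.Icc (-(60 * M ^ 4 : ℕ) : ℤ) (60 * M ^ 4 : ℕ) ×ˢ
          Finset.Icc (-(60 * M ^ 4 : ℕ) : ℤ) (60 * M ^ 4 : ℕ)).filter fun q =>
            q.1 ^ 2 - (β ^ 2 - α * γ) * q.2 ^ 2 = 3 * (3 * (α * η - β * δ) ^ 2 +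
              (β ^ 2 - α * γ) * (α * φ - 3 * δ ^ 2))).card := by
  have hM' : (1 : ℤ) ≤ M := by exact_mod_cast hM
  have hprod : ∀ x y A B : ℤ, |x| ≤ A → |y| ≤ B → |x * y| ≤ A * B := fun x y A B hx hy => by
    rw [abs_mul]
    exact mul_le_mul hx hy (abs_nonneg _) ((abs_nonneg _).trans hx)
  refine Finset.card_le_card_of_injOn (fun q : ℤ × ℤ =>
    (3 * ((β ^ 2 - α * γ) * q.2 - (α * η - β * δ)), 3 * (α * q.1 + β * q.2 + δ))) ?_ ?_
  · rintro ⟨a, b⟩ hq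
    simp only [Finset.coe_filter, Finset.mem_product, Finset.mem_Icc,
      Set.mem_ofPred_eq, ← abs_le] at hq ⊢
    obtain ⟨⟨⟨ha1, haQ⟩, hb1, hbQ⟩, hq⟩ := hq
    have hQM' : (Q : ℤ) ≤ M := by exact_mod_cast hQM
    have ha : |a| ≤ (M : ℤ) := by rw [abs_le]; constructor <;> linarith
    have hb : |b| ≤ (M : ℤ) := by rw [abs_le]; constructor <;> linarith
    have h₁ := hprod _ _ _ _ hβM hβM
    have h₂ := hprod _ _ _ _ hαM hγM
    have h₃ := hprod _ _ _ _ hαM hηM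
    have h₄ := hprod _ _ _ _ hβM hδM
    have h₅ := hprod _ _ _ _ hαM ha
    have h₆ := hprod _ _ _ _ hβM hb
    have hDM : |β ^ 2 - α * γ| ≤ 2 * (M : ℤ) ^ 2 := by
      rw [abs_le] at *; constructor <;> nlinarith
    have h₇ := hprod _ _ _ _ hDM hb
    have hM2 : (M : ℤ) ≤ M ^ 2 := by nlinarith
    have hM3 : (M : ℤ) ^ 2 ≤ M ^ 3 := by nlinarith [sq_nonneg (M : ℤ)]
    have hM4 : (M : ℤ) ^ 3 ≤ M ^ 4 := by nlinarith [pow_nonneg (by linarith : (0 : ℤ) ≤ M) 3]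
    have hexp : 2 * (M : ℤ) ^ 2 * M = 2 * M ^ 3 := by ring
    have hsq : (M : ℤ) * M = M ^ 2 := by ring
    rw [hexp] at h₇
    rw [hsq] at h₁ h₂ h₃ h₄ h₅ h₆
    refine ⟨⟨?_, ?_⟩, ?_⟩
    · push_cast
      rw [abs_le] at *
      constructor <;> linarith
    · push_cast
      rw [abs_le] at *
      constructor <;> linarith
    · linear_combination (-3 * α * (β ^ 2 - α * γ)) * hq
  · rintro ⟨a, b⟩ - ⟨a', b'⟩ - heq
    simp only [Prod.mk.injEq] at heq
    have hb : b = b' := mul_left_cancel₀ hD (by linarith [heq.1])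
    subst hb
    have ha : a = a' := mul_left_cancel₀ hα (by linarith [heq.2])
    rw [ha]

theorem abs_pell_data_le {α β γ δ η φ : ℤ} {M : ℕ} (hM : 1 ≤ M) (hαM : |α| ≤ M) (hβM : |β| ≤ M)
    (hγM : |γ| ≤ M) (hδM : |δ| ≤ M) (hηM : |η| ≤ M) (hφM : |φ| ≤ M) :
    |β ^ 2 - α * γ| ≤ 60 * (M : ℤ) ^ 4 ∧
      |3 * (3 * (α * η - β * δ) ^ 2 + (β ^ 2 - α * γ) * (α * φ - 3 * δ ^ 2))| ≤
        60 * (M : ℤ) ^ 4 := by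
  have hM' : (1 : ℤ) ≤ M := by exact_mod_cast hM
  have hprod : ∀ x y A B : ℤ, |x| ≤ A → |y| ≤ B → |x * y| ≤ A * B := fun x y A B hx hy => by
    rw [abs_mul]
    exact mul_le_mul hx hy (abs_nonneg _) ((abs_nonneg _).trans hx)
  have h₁ := hprod _ _ _ _ hβM hβM
  have h₂ := hprod _ _ _ _ hαM hγM
  have h₃ := hprod _ _ _ _ hαM hηM
  have h₄ := hprod _ _ _ _ hβM hδM
  have h₅ := hprod _ _ _ _ hαM hφM
  have h₆ := hprod _ _ _ _ hδM hδM
  have hDM : |β ^ 2 - α * γ| ≤ 2 * (M : ℤ) ^ 2 := by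
    rw [abs_le] at *; constructor <;> nlinarith
  have hEM : |α * η - β * δ| ≤ 2 * (M : ℤ) ^ 2 := by
    rw [abs_le] at *; constructor <;> nlinarith
  have hFM : |α * φ - 3 * δ ^ 2| ≤ 4 * (M : ℤ) ^ 2 := by
    rw [abs_le] at *; constructor <;> nlinarith
  have hM2 : (0 : ℤ) ≤ (M : ℤ) ^ 2 := by positivity
  have hM4 : (M : ℤ) ^ 2 ≤ M ^ 4 := pow_le_pow_right₀ hM' (by norm_num)
  have h₇ := hprod _ _ _ _ hEM hEM
  have h₈ := hprod _ _ _ _ hDM hFM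
  have e₇ : 2 * (M : ℤ) ^ 2 * (2 * M ^ 2) = 4 * M ^ 4 := by ring
  have e₈ : 2 * (M : ℤ) ^ 2 * (4 * M ^ 2) = 8 * M ^ 4 := by ring
  rw [e₇, ← sq] at h₇
  rw [e₈] at h₈
  refine ⟨hDM.trans (by linarith), ?_⟩
  rw [abs_le] at *
  constructor <;> linarith

theorem card_filter_intBox_mul_sq_le {s c Q : ℕ} (P : (Fin s → ℤ) → Prop) [DecidablePred P]
    {u v : Fin s → ℤ} (huv : ∀ i, |u i| + |v i| + 1 ≤ c) :
    ((intBox s Q).filter P).card * Q ^ 2 ≤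
      ∑ w ∈ intBox s (c * Q), ((Finset.Icc (1 : ℤ) Q ×ˢ Finset.Icc (1 : ℤ) Q).filter
        fun q => P (w + q.1 • u + q.2 • v)).card := by
  classical
  have hQ : (Finset.Icc (1 : ℤ) Q).card = Q := by rw [Int.card_Icc]; omega
  have hR : ∑ w ∈ intBox s (c * Q), ((Finset.Icc (1 : ℤ) Q ×ˢ Finset.Icc (1 : ℤ) Q).filter
        fun q => P (w + q.1 • u + q.2 • v)).card =
      ((intBox s (c * Q) ×ˢ (Finset.Icc (1 : ℤ) Q ×ˢ Finset.Icc (1 : ℤ) Q)).filter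
        fun r => P (r.1 + r.2.1 • u + r.2.2 • v)).card := by
    simp only [Finset.card_filter]
    rw [Finset.sum_product]
  have hL : ((intBox s Q).filter P).card * Q ^ 2 =
      (((intBox s Q).filter P) ×ˢ (Finset.Icc (1 : ℤ) Q ×ˢ Finset.Icc (1 : ℤ) Q)).card := by
    rw [Finset.card_product, Finset.card_product, hQ, sq]
  rw [hR, hL]
  refine Finset.card_le_card_of_injOn (fun r => (r.1 - r.2.1 • u - r.2.2 • v, r.2)) ?_ ?_
  · rintro ⟨z, a, b⟩ hr
    simp only [Finset.coe_product, Finset.coe_filter, Set.mem_prod, Set.mem_ofPred_eq,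
      Finset.coe_Icc, Set.mem_Icc, mem_intBox] at hr
    simp only [Finset.coe_filter, Finset.mem_product, Finset.mem_Icc, Set.mem_ofPred_eq,
      mem_intBox]
    obtain ⟨⟨hz, hP⟩, ⟨ha1, haQ⟩, hb1, hbQ⟩ := hr
    refine ⟨⟨fun i => ?_, ⟨ha1, haQ⟩, hb1, hbQ⟩, ?_⟩
    · have h₁ : |a * u i| ≤ Q * |u i| := by
        rw [abs_mul, abs_of_nonneg (by linarith : (0 : ℤ) ≤ a)]
        exact mul_le_mul_of_nonneg_right haQ (abs_nonneg _)
      have h₂ : |b * v i| ≤ Q * |v i| := by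
        rw [abs_mul, abs_of_nonneg (by linarith : (0 : ℤ) ≤ b)]
        exact mul_le_mul_of_nonneg_right hbQ (abs_nonneg _)
      have h₃ := mul_le_mul_of_nonneg_left (huv i) (Int.natCast_nonneg Q)
      have h₄ := hz i
      have h₅ := abs_sub (z i - a * u i) (b * v i)
      have h₆ := abs_sub (z i) (a * u i)
      simp only [Pi.sub_apply, Pi.smul_apply, smul_eq_mul]
      push_cast
      linarith
    · convert hP using 1
      abel
  · rintro ⟨z, q⟩ - ⟨z', q'⟩ - heq
    simp only [Prod.mk.injEq] at heq
    obtain ⟨h, rfl⟩ := heq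
    rw [sub_left_inj, sub_left_inj] at h
    rw [h]

theorem card_filter_eval_le {s : ℕ} {p : MvPolynomial (Fin s) ℤ} {t : Fin s → Fin s → Fin s → ℤ}
    (ht : ∀ x, symTrilinear t x x x = 6 * eval x p) (P : ℝ) :
    Nat.card {x : (Fin s → ℤ) × (Fin s → ℤ) //
        (∀ j, (|x.1 j| : ℝ) ≤ P) ∧ (∀ j, (|x.2 j| : ℝ) ≤ P) ∧ eval x.1 p = eval x.2 p} ≤
      ∑ h ∈ intBox s (2 * ⌊P⌋₊), ((intBox s (2 * ⌊P⌋₊)).filter fun z =>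
        3 * symTrilinear t h z z + symTrilinear t h h h = 0).card := by
  classical
  rw [← Finset.card_sigma, ← Fintype.card_coe, ← Nat.card_eq_fintype_card]
  have hcoord : ∀ x : Fin s → ℤ, (∀ j, (|x j| : ℝ) ≤ P) → ∀ j, |x j| ≤ ⌊P⌋₊ := by
    intro x hx j
    have h₁ : ((x j).natAbs : ℝ) ≤ P := by
      rw [Nat.cast_natAbs]
      exact_mod_cast hx j
    have h₂ := Nat.le_floor h₁
    zify at h₂
    exact h₂
  refine Nat.card_le_card_of_injective (fun x => ⟨⟨x.1.2 - x.1.1, x.1.2 + x.1.1⟩, ?_⟩) ?_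
  · obtain ⟨⟨x, y⟩, hx, hy, hxy⟩ := x
    simp only [Finset.mem_sigma, Finset.mem_filter, mem_intBox]
    refine ⟨fun i => ?_, fun i => ?_, ?_⟩
    · have h₁ := hcoord x hx i
      have h₂ := hcoord y hy i
      have h₃ := abs_sub (y i) (x i)
      rw [Pi.sub_apply]
      push_cast
      linarith
    · have h₁ := hcoord x hx i
      have h₂ := hcoord y hy i
      have h₃ := abs_add_le (y i) (x i)
      rw [Pi.add_apply]
      push_cast
      linarith
    · have hdiff := symTrilinear.diag_add_sub_diag_sub t (y - x) (y + x)
      have e₁ : y + x + (y - x) = (2 : ℤ) • y := by rw [two_smul]; abel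
      have e₂ : y + x - (y - x) = (2 : ℤ) • x := by rw [two_smul]; abel
      simp only [e₁, e₂, symTrilinear.smul_left, symTrilinear.smul_mid, symTrilinear.smul_right]
        at hdiff
      have hxy' : eval x p = eval y p := hxy
      rw [ht y, ht x, hxy', sub_self] at hdiff
      linarith
  · rintro ⟨⟨x, y⟩, hx⟩ ⟨⟨x', y'⟩, hx'⟩ heq
    simp only [Subtype.mk.injEq, Sigma.mk.injEq, heq_eq_eq] at heq
    obtain ⟨h₁, h₂⟩ := heq
    have hy : y = y' := funext fun i => by
      have := congrFun h₁ i
      have := congrFun h₂ i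
      simp only [Pi.sub_apply, Pi.add_apply] at *
      linarith
    subst hy
    have hx : x = x' := add_left_cancel h₂
    subst hx
    rfl

theorem symTrilinear_eq_zero_of_cubicDiff_eq_zero {s : ℕ} {t : Fin s → Fin s → Fin s → ℤ}
    {h : Fin s → ℤ} (hF : ∀ z, 3 * symTrilinear t h z z + symTrilinear t h h h = 0)
    (y z : Fin s → ℤ) : symTrilinear t h y z = 0 := by
  have h₀ : symTrilinear t h h h = 0 := by
    have := hF 0
    rwa [symTrilinear.zero_mid, mul_zero, zero_add] at this
  have hy := hF y
  have hz := hF z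
  have hyz := hF (y + z)
  rw [symTrilinear.add_mid, symTrilinear.add_right, symTrilinear.add_right,
    symTrilinear.swap_right t h z y] at hyz
  linarith

theorem card_filter_radical_mul_sq_le {s c Q : ℕ} {t : Fin s → Fin s → Fin s → ℤ}
    {u v h₀ : Fin s → ℤ} (huv : ∀ i, |u i| + |v i| + 1 ≤ c)
    (hD : symTrilinear t h₀ u v ^ 2 - symTrilinear t h₀ u u * symTrilinear t h₀ v v ≠ 0)
    [DecidablePred fun h : Fin s → ℤ => ∀ y z, symTrilinear t h y z = 0] :
    ((intBox s Q).filter fun h => ∀ y z, symTrilinear t h y z = 0).card * Q ^ 2 ≤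
      (2 * (c * Q) + 1) ^ s := by
  refine (card_filter_intBox_mul_sq_le _ huv).trans ?_
  rw [← card_intBox, Finset.card_eq_sum_ones]
  refine Finset.sum_le_sum fun w _ => Finset.card_le_one.mpr ?_
  rintro ⟨a, b⟩ h₁ ⟨a', b'⟩ h₂
  have h₁ := (Finset.mem_filter.mp h₁).2
  have h₂ := (Finset.mem_filter.mp h₂).2
  have key : ∀ y, (a - a') * symTrilinear t h₀ u y + (b - b') * symTrilinear t h₀ v y = 0 := by
    intro y
    have e₁ := h₁ h₀ y
    have e₂ := h₂ h₀ y
    rw [symTrilinear.swap_left] at e₁ e₂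
    simp only [symTrilinear.add_mid, symTrilinear.smul_mid] at e₁ e₂
    linarith
  have hu := key u
  have hv := key v
  rw [symTrilinear.swap_right t h₀ v u] at hu
  have ha : a - a' = 0 := by
    refine (mul_eq_zero.mp ?_).resolve_right hD
    linear_combination (-symTrilinear t h₀ v v) * hu + symTrilinear t h₀ u v * hv
  have hb : b - b' = 0 := by
    refine (mul_eq_zero.mp ?_).resolve_right hD
    linear_combination symTrilinear t h₀ u v * hu - symTrilinear t h₀ u u * hv
  rw [sub_eq_zero.mp ha, sub_eq_zero.mp hb]

theorem isPolynomialFun_cubicDiff {s : ℕ} (t : Fin s → Fin s → Fin s → ℤ) (h : Fin s → ℤ) :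
    IsPolynomialFun 2 fun z => 3 * symTrilinear t h z z + symTrilinear t h h h :=
  .add (.const_mul _ (.symTrilinear t (a := 0) (b := 1) (c := 1) (X := fun _ => h)
    (fun _ => .const 0 _) .coord .coord)) (.const 2 _)

theorem card_filter_cubicDiff_mul_sq_le {s c Q M : ℕ} (hs : 1 ≤ s)
    {t : Fin s → Fin s → Fin s → ℤ} {u v h : Fin s → ℤ} (huv : ∀ i, |u i| + |v i| + 1 ≤ c)
    (hα : symTrilinear t h u u ≠ 0)
    (hD : symTrilinear t h u v ^ 2 - symTrilinear t h u u * symTrilinear t h v v ≠ 0)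
    (hh : symTrilinear t h h h ≠ 0) (hM : 1 ≤ M) (hQM : Q ≤ M)
    (hαM : |symTrilinear t h u u| ≤ M) (hβM : |symTrilinear t h u v| ≤ M)
    (hγM : |symTrilinear t h v v| ≤ M)
    (hδM : ∀ w ∈ intBox s (c * Q), |symTrilinear t h w u| ≤ M)
    (hηM : ∀ w ∈ intBox s (c * Q), |symTrilinear t h w v| ≤ M)
    (hφM : ∀ w ∈ intBox s (c * Q), |3 * symTrilinear t h w w + symTrilinear t h h h| ≤ M)
    {κ : ℝ} (hκ0 : 0 ≤ κ) (hκ : ∀ D N : ℤ, D ≠ 0 → N ≠ 0 → D.natAbs ≤ 60 * M ^ 4 →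
      N.natAbs ≤ 60 * M ^ 4 → (((Finset.Icc (-(60 * M ^ 4 : ℕ) : ℤ) (60 * M ^ 4 : ℕ) ×ˢ
          Finset.Icc (-(60 * M ^ 4 : ℕ) : ℤ) (60 * M ^ 4 : ℕ)).filter fun q =>
            q.1 ^ 2 - D * q.2 ^ 2 = N).card : ℝ) ≤ κ) :
    (((intBox s Q).filter fun z =>
        3 * symTrilinear t h z z + symTrilinear t h h h = 0).card : ℝ) * (Q : ℝ) ^ 2 ≤
      (2 * (c * Q) + 1) ^ s * κ + 2 * (2 * (c * Q) + 1) ^ (s - 1) * (2 * Q) := by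
  classical
  set α := symTrilinear t h u u
  set β := symTrilinear t h u v
  set γ := symTrilinear t h v v
  set N : (Fin s → ℤ) → ℤ := fun w =>
    3 * (α * symTrilinear t h w v - β * symTrilinear t h w u) ^ 2 + (β ^ 2 - α * γ) *
      (α * (3 * symTrilinear t h w w + symTrilinear t h h h) - 3 * symTrilinear t h w u ^ 2)
    with hN
  have hlin : ∀ y, IsPolynomialFun 1 fun w => symTrilinear t h w y := fun y =>
    .symTrilinear t (a := 0) (b := 1) (c := 0) (X := fun _ => h) (Z := fun _ => y)
      (fun _ => .const 0 _) .coord (fun _ => .const 0 _)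
  have hNpoly : IsPolynomialFun 2 N := by
    have hsq : ∀ {g : (Fin s → ℤ) → ℤ}, IsPolynomialFun 1 g → IsPolynomialFun 2 fun w => g w ^ 2 :=
      fun hg => by simpa only [sq] using hg.mul hg
    exact .add (.const_mul _ (hsq (.sub (.const_mul _ (hlin v)) (.const_mul _ (hlin u)))))
      (.const_mul _ (.sub (.const_mul _ (isPolynomialFun_cubicDiff t h))
        (.const_mul _ (hsq (hlin u)))))
  have hN0 : ∃ w, N w ≠ 0 := by
    refine ⟨0, ?_⟩
    simp only [hN, symTrilinear.zero_mid]
    have := mul_ne_zero hD (mul_ne_zero hα hh)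
    convert this using 1
    ring
  have hzero := hNpoly.card_zeros_le hs hN0 (c * Q)
  have hmain := card_filter_intBox_mul_sq_le (Q := Q)
    (fun z => 3 * symTrilinear t h z z + symTrilinear t h h h = 0) huv
  simp only [symTrilinear.add_smul_add_smul] at hmain
  have hpt : ∀ w ∈ intBox s (c * Q),
      (((Finset.Icc (1 : ℤ) Q ×ˢ Finset.Icc (1 : ℤ) Q).filter fun q =>
        3 * (α * q.1 ^ 2 + 2 * β * q.1 * q.2 + γ * q.2 ^ 2 + 2 * symTrilinear t h w u * q.1 +
          2 * symTrilinear t h w v * q.2) + (3 * symTrilinear t h w w + symTrilinear t h h h)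
            = 0).card : ℝ) ≤ κ + if N w = 0 then 2 * (Q : ℝ) else 0 := by
    intro w hw
    by_cases hNw : N w = 0
    · rw [if_pos hNw]
      refine le_trans (Nat.cast_le.mpr (card_quadratic_zeros_le hα Q)) ?_
      push_cast
      linarith
    · rw [if_neg hNw, add_zero]
      obtain ⟨h₁, h₂⟩ := abs_pell_data_le hM hαM hβM hγM (hδM w hw) (hηM w hw) (hφM w hw)
      refine le_trans (Nat.cast_le.mpr (card_quadratic_zeros_le_card_pell hα hD hM hQM hαM hβM hγM
        (hδM w hw) (hηM w hw))) (hκ _ _ hD (mul_ne_zero (by norm_num) hNw) ?_ ?_)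
      · zify
        exact h₁
      · zify
        exact h₂
  have hmainR := (Nat.cast_le (α := ℝ)).mpr hmain
  push_cast at hmainR
  refine hmainR.trans ((Finset.sum_le_sum hpt).trans ?_)
  rw [Finset.sum_add_distrib, Finset.sum_const, card_intBox, nsmul_eq_mul, ← Finset.sum_filter,
    Finset.sum_const, nsmul_eq_mul]
  have hzeroR : (((intBox s (c * Q)).filter fun w => N w = 0).card : ℝ) ≤
      2 * (2 * (c * Q) + 1) ^ (s - 1) := by exact_mod_cast hzero
  push_cast
  gcongr

theorem exists_symTrilinear_bound {s : ℕ} (t : Fin s → Fin s → Fin s → ℤ) {c : ℕ} (hc : 1 ≤ c)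
    {u v : Fin s → ℤ} (huv : ∀ i, |u i| + |v i| + 1 ≤ c) :
    ∃ L : ℕ, 1 ≤ L ∧ ∀ Q : ℕ, 1 ≤ Q → ∀ h ∈ intBox s Q,
      |symTrilinear t h u u| ≤ (L * Q ^ 3 : ℕ) ∧ |symTrilinear t h u v| ≤ (L * Q ^ 3 : ℕ) ∧
      |symTrilinear t h v v| ≤ (L * Q ^ 3 : ℕ) ∧ ∀ w ∈ intBox s (c * Q),
        |symTrilinear t h w u| ≤ (L * Q ^ 3 : ℕ) ∧ |symTrilinear t h w v| ≤ (L * Q ^ 3 : ℕ) ∧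
        |3 * symTrilinear t h w w + symTrilinear t h h h| ≤ (L * Q ^ 3 : ℕ) := by
  set A : ℤ := 6 * ∑ i, ∑ j, ∑ k, |t i j k| with hA
  have hA0 : 0 ≤ A := by positivity
  obtain ⟨L, hL⟩ := Int.eq_ofNat_of_zero_le (by positivity : 0 ≤ 4 * (A * c ^ 2) + 1)
  refine ⟨L, ?_, fun Q hQ h hh => ?_⟩
  · have : 0 ≤ A * (c : ℤ) ^ 2 := by positivity
    omega
  have hc' : (1 : ℤ) ≤ c := by exact_mod_cast hc
  have hQ' : (1 : ℤ) ≤ Q := by exact_mod_cast hQ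
  have hgen : ∀ {y z : Fin s → ℤ}, (∀ i, |y i| ≤ (c : ℤ) * Q) → (∀ i, |z i| ≤ (c : ℤ) * Q) →
      |symTrilinear t h y z| ≤ A * c ^ 2 * Q ^ 3 := by
    intro y z hy hz
    refine (symTrilinear.abs_le t (by positivity) (by positivity) (mem_intBox.mp hh) hy hz).trans
      (le_of_eq ?_)
    ring
  have hcQ : (c : ℤ) ≤ c * Q := le_mul_of_one_le_right (by positivity) hQ'
  have hu : ∀ i, |u i| ≤ (c : ℤ) * Q := fun i => by
    have := huv i
    have := abs_nonneg (v i)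
    linarith
  have hv : ∀ i, |v i| ≤ (c : ℤ) * Q := fun i => by
    have := huv i
    have := abs_nonneg (u i)
    linarith
  have hh' : ∀ i, |h i| ≤ (c : ℤ) * Q := fun i =>
    (mem_intBox.mp hh i).trans (le_mul_of_one_le_left (by positivity) hc')
  have h0 : 0 ≤ A * (c : ℤ) ^ 2 * Q ^ 3 := by positivity
  have hLQ : ((L * Q ^ 3 : ℕ) : ℤ) = 4 * (A * c ^ 2 * Q ^ 3) + Q ^ 3 := by
    have : (L : ℤ) = 4 * (A * c ^ 2) + 1 := hL.symm
    push_cast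
    rw [this]
    ring
  have hQ3 : (0 : ℤ) ≤ (Q : ℤ) ^ 3 := by positivity
  rw [hLQ]
  refine ⟨(hgen hu hu).trans ?_, (hgen hu hv).trans ?_, (hgen hv hv).trans ?_, fun w hw => ?_⟩
  · linarith
  · linarith
  · linarith
  have hw' : ∀ i, |w i| ≤ (c : ℤ) * Q := fun i => by exact_mod_cast mem_intBox.mp hw i
  refine ⟨(hgen hw' hu).trans ?_, (hgen hw' hv).trans ?_, ?_⟩
  · linarith
  · linarith
  have h₁ := hgen hw' hw'
  have h₂ := hgen hh' hh'
  rw [abs_le] at *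
  constructor <;> linarith

theorem sum_card_filter_cubicDiff_mul_sq_le {s c Q : ℕ} (hs : 1 ≤ s)
    {t : Fin s → Fin s → Fin s → ℤ} {u v h₀ : Fin s → ℤ} (huv : ∀ i, |u i| + |v i| + 1 ≤ c)
    (hu : symTrilinear t u u u ≠ 0)
    (hD : symTrilinear t h₀ u v ^ 2 - symTrilinear t h₀ u u * symTrilinear t h₀ v v ≠ 0)
    (hc : 1 ≤ c) {A : ℝ} (hA : 0 ≤ A)
    (hgood : ∀ h ∈ intBox s Q, symTrilinear t h u u ≠ 0 →
      symTrilinear t h u v ^ 2 - symTrilinear t h u u * symTrilinear t h v v ≠ 0 →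
      symTrilinear t h h h ≠ 0 → (((intBox s Q).filter fun z =>
        3 * symTrilinear t h z z + symTrilinear t h h h = 0).card : ℝ) * (Q : ℝ) ^ 2 ≤ A) :
    (∑ h ∈ intBox s Q, ((intBox s Q).filter fun z =>
        3 * symTrilinear t h z z + symTrilinear t h h h = 0).card : ℝ) * (Q : ℝ) ^ 2 ≤
      (2 * (c * Q) + 1) ^ s * A +
        6 * (2 * (c * Q) + 1) ^ (s - 1) * (2 * (2 * (c * Q) + 1) ^ (s - 1) * (Q : ℝ) ^ 2) +
        (2 * (c * Q) + 1) ^ s * (2 * (c * Q) + 1) ^ s := by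
  classical
  have hlin : ∀ y z : Fin s → ℤ, IsPolynomialFun 1 fun h => symTrilinear t h y z := fun y z =>
    .symTrilinear t (a := 1) (b := 0) (c := 0) (Y := fun _ => y) (Z := fun _ => z)
      .coord (fun _ => .const 0 _) (fun _ => .const 0 _)
  set f : (Fin s → ℤ) → ℤ := fun h => symTrilinear t h u u *
    (symTrilinear t h u v * symTrilinear t h u v - symTrilinear t h u u * symTrilinear t h v v) *
      symTrilinear t h h h with hf
  have hDpoly : IsPolynomialFun 2 fun h => symTrilinear t h u v * symTrilinear t h u v -
      symTrilinear t h u u * symTrilinear t h v v :=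
    .sub ((hlin u v).mul (hlin u v)) ((hlin u u).mul (hlin v v))
  have hdiag : IsPolynomialFun 3 fun h : Fin s → ℤ => symTrilinear t h h h :=
    .symTrilinear t (a := 1) (b := 1) (c := 1) .coord .coord .coord
  have hfpoly : IsPolynomialFun 6 f := ((hlin u u).mul hDpoly).mul hdiag
  have hf0 : ∃ h, f h ≠ 0 :=
    ((hlin u u).mul hDpoly).exists_mul_ne_zero hdiag
      ((hlin u u).exists_mul_ne_zero hDpoly ⟨u, hu⟩ ⟨h₀, by rwa [← sq]⟩) ⟨u, hu⟩
  have hcQ : (Q : ℝ) ≤ c * Q :=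
    le_mul_of_one_le_left (Nat.cast_nonneg Q) (by exact_mod_cast hc)
  set B : ℝ := 2 * (c * Q) + 1 with hB
  have hQB : 2 * (Q : ℝ) + 1 ≤ B := by rw [hB]; linarith
  have hB0 : 0 ≤ B := by positivity
  have hbad : (((intBox s Q).filter fun h => f h = 0).card : ℝ) ≤ 6 * B ^ (s - 1) := by
    have h₁ : (((intBox s Q).filter fun h => f h = 0).card : ℝ) ≤
        6 * (2 * (Q : ℝ) + 1) ^ (s - 1) := by exact_mod_cast hfpoly.card_zeros_le hs hf0 Q
    refine h₁.trans ?_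
    gcongr
  have hrad : (((intBox s Q).filter fun h => ∀ y z, symTrilinear t h y z = 0).card : ℝ) *
      (Q : ℝ) ^ 2 ≤ B ^ s := by
    rw [hB]
    exact_mod_cast card_filter_radical_mul_sq_le (Q := Q) huv hD
  have hall : ∀ h : Fin s → ℤ, (((intBox s Q).filter fun z =>
      3 * symTrilinear t h z z + symTrilinear t h h h = 0).card : ℝ) ≤ B ^ s := by
    intro h
    have h₁ : (((intBox s Q).filter fun z =>
        3 * symTrilinear t h z z + symTrilinear t h h h = 0).card : ℝ) ≤
        (2 * (Q : ℝ) + 1) ^ s := by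
      have := (Finset.card_filter_le (intBox s Q) fun z =>
        3 * symTrilinear t h z z + symTrilinear t h h h = 0).trans_eq (card_intBox s Q)
      exact_mod_cast this
    refine h₁.trans ?_
    gcongr
  have hpt : ∀ h ∈ intBox s Q, (((intBox s Q).filter fun z =>
      3 * symTrilinear t h z z + symTrilinear t h h h = 0).card : ℝ) * (Q : ℝ) ^ 2 ≤
      A + (if f h = 0 then 2 * B ^ (s - 1) * (Q : ℝ) ^ 2 else 0) +
        (if ∀ y z, symTrilinear t h y z = 0 then B ^ s * (Q : ℝ) ^ 2 else 0) := by
    intro h hh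
    by_cases hW : ∀ y z, symTrilinear t h y z = 0
    · rw [if_pos hW]
      have h₁ := mul_le_mul_of_nonneg_right (hall h) (sq_nonneg (Q : ℝ))
      have h₂ : 0 ≤ if f h = 0 then 2 * B ^ (s - 1) * (Q : ℝ) ^ 2 else 0 := by positivity
      linarith
    rw [if_neg hW, add_zero]
    by_cases hfh : f h = 0
    · rw [if_pos hfh]
      have hz : ∃ z, 3 * symTrilinear t h z z + symTrilinear t h h h ≠ 0 := by
        by_contra! hcon
        exact hW (symTrilinear_eq_zero_of_cubicDiff_eq_zero hcon)
      have h₁ : (((intBox s Q).filter fun z =>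
          3 * symTrilinear t h z z + symTrilinear t h h h = 0).card : ℝ) ≤
          2 * (2 * (Q : ℝ) + 1) ^ (s - 1) := by
        exact_mod_cast (isPolynomialFun_cubicDiff t h).card_zeros_le hs hz Q
      have h₂ : 2 * (2 * (Q : ℝ) + 1) ^ (s - 1) ≤ 2 * B ^ (s - 1) := by gcongr
      have h₃ := mul_le_mul_of_nonneg_right (h₁.trans h₂) (sq_nonneg (Q : ℝ))
      linarith
    · rw [if_neg hfh, add_zero]
      have h₁ := right_ne_zero_of_mul hfh
      have h₂ := left_ne_zero_of_mul hfh
      refine hgood h hh (left_ne_zero_of_mul h₂) ?_ h₁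
      rw [sq]
      exact right_ne_zero_of_mul h₂
  rw [Finset.sum_mul]
  refine (Finset.sum_le_sum hpt).trans ?_
  rw [Finset.sum_add_distrib, Finset.sum_add_distrib, Finset.sum_const, card_intBox,
    ← Finset.sum_filter, ← Finset.sum_filter, Finset.sum_const, Finset.sum_const, nsmul_eq_mul,
    nsmul_eq_mul, nsmul_eq_mul]
  refine add_le_add (add_le_add ?_ ?_) ?_
  · push_cast
    gcongr
  · gcongr
  · calc _ = B ^ s * (_ * (Q : ℝ) ^ 2) := by ring
      _ ≤ _ := by gcongr

theorem exists_sum_card_filter_cubicDiff_le {s : ℕ} (hs : 2 ≤ s)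
    {t : Fin s → Fin s → Fin s → ℤ} {u v h₀ : Fin s → ℤ} (hu : symTrilinear t u u u ≠ 0)
    (hD : symTrilinear t h₀ u v ^ 2 - symTrilinear t h₀ u u * symTrilinear t h₀ v v ≠ 0)
    {ε : ℝ} (hε : 0 < ε) :
    ∃ K : ℝ, 0 ≤ K ∧ ∀ Q : ℕ, 1 ≤ Q →
      (∑ h ∈ intBox s Q, ((intBox s Q).filter fun z =>
        3 * symTrilinear t h z z + symTrilinear t h h h = 0).card : ℝ) ≤
          K * (Q : ℝ) ^ (2 * (s : ℝ) - 2 + ε) := by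
  obtain ⟨c, huv⟩ : ∃ c : ℕ, ∀ i, |u i| + |v i| + 1 ≤ c := by
    refine ⟨∑ i, (|u i| + |v i| + 1).toNat, fun i => (Int.self_le_toNat _).trans ?_⟩
    exact_mod_cast Finset.single_le_sum
      (f := fun i => (|u i| + |v i| + 1).toNat) (fun _ _ => Nat.zero_le _) (Finset.mem_univ i)
  have hc : 1 ≤ c := by
    have h₁ := huv ⟨0, by omega⟩
    have h₂ := abs_nonneg (u ⟨0, by omega⟩)
    have h₃ := abs_nonneg (v ⟨0, by omega⟩)
    omega
  obtain ⟨L, hL, hLbound⟩ := exists_symTrilinear_bound t hc huv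
  obtain ⟨K, hK0, hK⟩ := exists_card_sq_sub_mul_sq_eq_le_rpow (ε / 12) (by positivity)
  set K₁ : ℝ := K * (60 * (L : ℝ) ^ 4) ^ (ε / 12) with hK₁
  have hK₁0 : 0 ≤ K₁ := by positivity
  refine ⟨(3 * c) ^ (2 * s) * (K₁ + 17), by positivity, fun Q hQ => ?_⟩
  have hQ' : (1 : ℝ) ≤ Q := by exact_mod_cast hQ
  have hc' : (1 : ℝ) ≤ c := by exact_mod_cast hc
  have hM : 1 ≤ L * Q ^ 3 := Nat.mul_pos hL (pow_pos hQ 3)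
  have hQM : Q ≤ L * Q ^ 3 :=
    (Nat.le_self_pow (by norm_num) Q).trans (Nat.le_mul_of_pos_left _ hL)
  have hR : 2 ≤ 60 * (L * Q ^ 3) ^ 4 := by
    have := Nat.pow_pos (n := 4) hM
    omega
  have hκ : K * ((60 * (L * Q ^ 3) ^ 4 : ℕ) : ℝ) ^ (ε / 12) = K₁ * (Q : ℝ) ^ ε := by
    have h₁ : ((60 * (L * Q ^ 3) ^ 4 : ℕ) : ℝ) = (60 * (L : ℝ) ^ 4) * (Q : ℝ) ^ 12 := by
      push_cast
      ring
    rw [h₁, Real.mul_rpow (by positivity) (by positivity), ← Real.rpow_natCast (Q : ℝ) 12,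
      ← Real.rpow_mul (by positivity), hK₁, mul_assoc]
    congr 3
    push_cast
    ring
  have hκ0 : 0 ≤ K₁ * (Q : ℝ) ^ ε := by positivity
  have hmain := sum_card_filter_cubicDiff_mul_sq_le (Q := Q) (by omega : 1 ≤ s) huv hu hD hc
    (A := (2 * (c * Q) + 1) ^ s * (K₁ * (Q : ℝ) ^ ε) +
      2 * (2 * (c * Q) + 1) ^ (s - 1) * (2 * Q)) (by positivity) (by
      intro h hh hα hDh hhh
      obtain ⟨b₁, b₂, b₃, hb⟩ := hLbound Q hQ h hh
      refine card_filter_cubicDiff_mul_sq_le (by omega) huv hα hDh hhh hM hQM b₁ b₂ b₃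
        (fun w hw => (hb w hw).1) (fun w hw => (hb w hw).2.1) (fun w hw => (hb w hw).2.2) hκ0 ?_
      intro D N hD hN hDR hNR
      rw [← hκ]
      exact hK _ hR D N hD hN hDR hNR)
  set B : ℝ := 2 * (c * Q) + 1 with hB
  have hcQ : 1 ≤ (c : ℝ) * Q := one_le_mul_of_one_le_of_one_le hc' hQ'
  have hQB : (Q : ℝ) ≤ B := by nlinarith
  have hB0 : 0 ≤ B := by positivity
  have hB3 : B ≤ 3 * c * Q := by linarith
  have hBQ : B ^ (s - 1) * Q ≤ B ^ s := by
    calc B ^ (s - 1) * Q ≤ B ^ (s - 1) * B := by gcongr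
      _ = B ^ s := pow_sub_one_mul (by omega) B
  have hBQ2 : (B ^ (s - 1) * Q) ^ 2 ≤ (B ^ s) ^ 2 := by gcongr
  have hBQ1 : B ^ s * (B ^ (s - 1) * Q) ≤ B ^ s * B ^ s := by gcongr
  have hBs : (B ^ s) ^ 2 ≤ (3 * c) ^ (2 * s) * (Q : ℝ) ^ (2 * s) := by
    rw [← mul_pow, ← pow_mul, mul_comm s 2]
    gcongr
  have hQε : 1 ≤ (Q : ℝ) ^ ε := Real.one_le_rpow hQ' hε.le
  have hfinal : (∑ h ∈ intBox s Q, ((intBox s Q).filter fun z =>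
        3 * symTrilinear t h z z + symTrilinear t h h h = 0).card : ℝ) * (Q : ℝ) ^ 2 ≤
      (3 * c) ^ (2 * s) * (K₁ + 17) * ((Q : ℝ) ^ (2 * s) * (Q : ℝ) ^ ε) := by
    refine hmain.trans ?_
    calc _ = (B ^ s) ^ 2 * (K₁ * (Q : ℝ) ^ ε) + 4 * (B ^ s * (B ^ (s - 1) * Q)) +
          12 * (B ^ (s - 1) * Q) ^ 2 + (B ^ s) ^ 2 := by ring
      _ ≤ (B ^ s) ^ 2 * (K₁ * (Q : ℝ) ^ ε + 17 * 1) := by linarith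
      _ ≤ (B ^ s) ^ 2 * (K₁ * (Q : ℝ) ^ ε + 17 * (Q : ℝ) ^ ε) := by gcongr
      _ ≤ ((3 * c) ^ (2 * s) * (Q : ℝ) ^ (2 * s)) * (K₁ * (Q : ℝ) ^ ε + 17 * (Q : ℝ) ^ ε) := by
        gcongr
      _ = _ := by ring
  have hQ0 : (0 : ℝ) < Q := by linarith
  have hexp : (Q : ℝ) ^ (2 * s) * (Q : ℝ) ^ ε =
      (Q : ℝ) ^ (2 * (s : ℝ) - 2 + ε) * (Q : ℝ) ^ 2 := by
    rw [← Real.rpow_natCast (Q : ℝ) (2 * s), ← Real.rpow_natCast (Q : ℝ) 2, ← Real.rpow_add hQ0,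
      ← Real.rpow_add hQ0]
    congr 1
    push_cast
    ring
  rw [hexp, ← mul_assoc] at hfinal
  exact le_of_mul_le_mul_right hfinal (by positivity)

/-- **Squarefree density of polynomials, Theorem 1.**
If `s ≥ 2` and `𝒞` is an integral cubic form in `s` variables not of the shape
`a(b₁x₁+⋯+b_sx_s)³` with `a, bᵢ ∈ ℚ`, then the number `M(P)` of pairs
`x, X ∈ [-P,P]^s` with `𝒞(x) = 𝒞(X)` satisfies `M(P) ≪ P^(2s-2+ε)`. -/
theorem squarefree_density_thm1 (s : ℕ) (hs : 2 ≤ s)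
    (𝒞 : MvPolynomial (Fin s) ℤ) (hhom : 𝒞.IsHomogeneous 3)
    (hdeg : ¬ ∃ (a : ℚ) (b : Fin s → ℚ),
      MvPolynomial.map (Int.castRingHom ℚ) 𝒞 =
        MvPolynomial.C a * (∑ i, MvPolynomial.C (b i) * MvPolynomial.X i) ^ 3)
    (ε : ℝ) (hε : 0 < ε) :
    ∃ K : ℝ, ∀ P : ℝ, 2 ≤ P →
      (Nat.card {x : (Fin s → ℤ) × (Fin s → ℤ) //
          (∀ j, (|x.1 j| : ℝ) ≤ P) ∧ (∀ j, (|x.2 j| : ℝ) ≤ P) ∧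
          eval x.1 𝒞 = eval x.2 𝒞} : ℝ)
        ≤ K * P ^ (2 * (s : ℝ) - 2 + ε) := by
  obtain ⟨t, hteval⟩ := hhom.exists_eval_eq_sum
  have ht : ∀ x, symTrilinear t x x x = 6 * eval x 𝒞 := fun x => by
    rw [symTrilinear.diag, hteval]
  obtain ⟨u, v, h₀, hu, hD⟩ := exists_discriminant_ne_zero ht hdeg
  obtain ⟨K, hK0, hK⟩ := exists_sum_card_filter_cubicDiff_le hs hu hD hε
  refine ⟨K * 2 ^ (2 * (s : ℝ) - 2 + ε), fun P hP => ?_⟩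
  have hs' : (2 : ℝ) ≤ s := by exact_mod_cast hs
  have hfloor : 1 ≤ ⌊P⌋₊ := Nat.le_floor (by push_cast; linarith)
  have h₁ : (Nat.card {x : (Fin s → ℤ) × (Fin s → ℤ) //
      (∀ j, (|x.1 j| : ℝ) ≤ P) ∧ (∀ j, (|x.2 j| : ℝ) ≤ P) ∧ eval x.1 𝒞 = eval x.2 𝒞} : ℝ) ≤
      ∑ h ∈ intBox s (2 * ⌊P⌋₊), ((intBox s (2 * ⌊P⌋₊)).filter fun z =>
        3 * symTrilinear t h z z + symTrilinear t h h h = 0).card := by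
    exact_mod_cast card_filter_eval_le ht P
  have hQP : ((2 * ⌊P⌋₊ : ℕ) : ℝ) ≤ 2 * P := by
    push_cast
    exact mul_le_mul_of_nonneg_left (Nat.floor_le (by linarith)) (by norm_num)
  calc _ ≤ _ := h₁
    _ ≤ K * ((2 * ⌊P⌋₊ : ℕ) : ℝ) ^ (2 * (s : ℝ) - 2 + ε) := by
      rw [Nat.cast_sum]
      exact hK _ (by omega)
    _ ≤ K * (2 * P) ^ (2 * (s : ℝ) - 2 + ε) := by
      gcongr
      linarith
    _ = _ := by rw [Real.mul_rpow (by norm_num) (by linarith), mul_assoc]
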